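/- arXiv:1806.04850 — 2 statements merged into one kernel-verified Lean document; each statement's English description precedes it below -/
import Mathlib

section
/- Let p be a prime and ψ : F_p → ℂˣ a nontrivial additive character. Let χ₁, χ₂ : F_{p^5}ˣ → ℂˣ be regular multiplicative characters such that G(χ₁·η, ψ) = G(χ₂·η, ψ) for every multiplicative character η : F_pˣ → ℂˣ. Then there exists an integer j such that χ₁(x) = χ₂(x^(p^j)) for all x ∈ F_{p^5}ˣ. -/
open scoped Classical

/-- The Gauss sum over `E` of the character `χ` twisted by the character `η` of the
base field `F` (pulled back via the norm map), with respect to the additive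
character `ψ` of `F` (composed with the trace map):
`G(χ·η, ψ) = ∑_{x ∈ Eˣ} χ(x) η(Nm(x)) ψ(Tr(x))`. -/
noncomputable def twistedGaussSum (F : Type) {E : Type} [Field F] [Field E] [Fintype F]
    [Fintype E] [Algebra F E] (χ : Eˣ →* ℂˣ) (η : Fˣ →* ℂˣ) (ψ : AddChar F ℂ) : ℂ :=
  ∑ x : Eˣ, ((χ x : ℂ) * (η (Units.map (Algebra.norm F : E →* F) x) : ℂ)) *
    ψ (Algebra.trace F E (x : E))

/-- A multiplicative character `χ` of `Eˣ` is *regular* if it does not factor through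
the norm map to any proper subfield of `E`. -/
def IsRegularChar {E : Type} [Field E] [Fintype E] (χ : Eˣ →* ℂˣ) : Prop :=
  ∀ K : Subfield E, K ≠ ⊤ →
    ¬ ∃ η : Kˣ →* ℂˣ, ∀ x : Eˣ, χ x = η (Units.map (Algebra.norm K : E →* K) x)

def repunit (p : ℕ) : ℕ := 1 + p + p ^ 2 + p ^ 3 + p ^ 4

def modulus (p : ℕ) : ℕ := (p - 1) * repunit p

lemma repunit_pos (p : ℕ) : 0 < repunit p := by unfold repunit; positivity

lemma modulus_add_one {p : ℕ} (hp : 2 ≤ p) : modulus p + 1 = p ^ 5 := by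
  obtain ⟨q, rfl⟩ : ∃ q, p = q + 1 := ⟨p - 1, by omega⟩
  simp only [modulus, repunit, Nat.add_sub_cancel]
  ring

lemma modulus_pos {p : ℕ} (hp : 2 ≤ p) : 0 < modulus p :=
  Nat.mul_pos (by omega) (repunit_pos p)

lemma pow_five_modEq {p : ℕ} (hp : 2 ≤ p) : p ^ 5 ≡ 1 [MOD modulus p] := by
  rw [← modulus_add_one hp]
  exact (Nat.modEq_iff_dvd' (by omega)).2 (by simp) |>.symm

lemma mul_repunit_modEq {p : ℕ} (hp : 2 ≤ p) (i : ℕ) :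
    p ^ i * repunit p ≡ repunit p [MOD modulus p] := by
  induction i with
  | zero => simp; rfl
  | succ i ih =>
    have h1 : p * repunit p = repunit p + modulus p := by
      obtain ⟨q, rfl⟩ : ∃ q, p = q + 1 := ⟨p - 1, by omega⟩
      simp only [modulus, Nat.add_sub_cancel]; ring
    have h2 : p * repunit p ≡ repunit p [MOD modulus p] := by
      rw [h1]; simp [Nat.ModEq]
    calc p ^ (i + 1) * repunit p = p * (p ^ i * repunit p) := by ring
      _ ≡ p * repunit p [MOD modulus p] := ih.mul_left _
      _ ≡ _ [MOD modulus p] := h2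

/-- The residue of `p ^ i * n` modulo `p ^ 5 - 1`. -/
def res (p n : ℕ) (i : Fin 5) : ℕ := p ^ (i : ℕ) * n % modulus p

/-- The base-`p` digits, most significant first, of `n` modulo `p ^ 5 - 1`. -/
def dig (p n : ℕ) (i : Fin 5) : ℕ := p * res p n i / modulus p

lemma res_lt {p : ℕ} (hp : 2 ≤ p) (n : ℕ) (i : Fin 5) : res p n i < modulus p :=
  Nat.mod_lt _ (modulus_pos hp)

lemma res_congr {p a b : ℕ} (h : a ≡ b [MOD modulus p]) : res p a = res p b := by
  funext i
  exact h.mul_left _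

lemma dig_congr {p a b : ℕ} (h : a ≡ b [MOD modulus p]) : dig p a = dig p b := by
  funext i
  simp only [dig, res_congr h]

lemma res_modEq (p n : ℕ) (i : Fin 5) : res p n i ≡ p ^ (i : ℕ) * n [MOD modulus p] :=
  Nat.mod_modEq _ _

lemma pow_mod_five {p : ℕ} (hp : 2 ≤ p) (i : ℕ) : p ^ (i % 5) ≡ p ^ i [MOD modulus p] := by
  conv_rhs => rw [← Nat.mod_add_div i 5, pow_add, pow_mul]
  simpa using ((pow_five_modEq hp).symm.pow (i / 5)).mul_left (p ^ (i % 5))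

lemma res_add {p : ℕ} (hp : 2 ≤ p) (n : ℕ) (i j : Fin 5) :
    res p n (i + j) = res p (p ^ (j : ℕ) * n) i := by
  simp only [res, Fin.val_add]
  have := (pow_mod_five hp (i + j)).mul_right n
  rw [pow_add, mul_assoc] at this
  exact this

lemma dig_add {p : ℕ} (hp : 2 ≤ p) (n : ℕ) (i j : Fin 5) :
    dig p n (i + j) = dig p (p ^ (j : ℕ) * n) i := by
  simp only [dig, res_add hp]

lemma mul_res {p : ℕ} (hp : 2 ≤ p) (n : ℕ) (i : Fin 5) :
    p * res p n i = modulus p * dig p n i + res p n (i + 1) := by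
  have h1 : res p n (i + 1) = p * res p n i % modulus p := by
    have h2 : p * res p n i ≡ p * (p ^ (i : ℕ) * n) [MOD modulus p] :=
      (res_modEq p n i).mul_left _
    have h3 := (pow_mod_five hp (i + 1)).mul_right n
    have h4 : res p n (i + 1) = p ^ ((i + 1) % 5 : ℕ) * n % modulus p := by
      simp only [res, Fin.val_add]; rfl
    rw [h4, h2, h3]
    congr 1; ring
  rw [h1, dig]
  exact (Nat.div_add_mod _ _).symm

lemma dig_lt {p : ℕ} (hp : 2 ≤ p) (n : ℕ) (i : Fin 5) : dig p n i < p := by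
  rw [dig, Nat.div_lt_iff_lt_mul (modulus_pos hp)]
  exact Nat.mul_lt_mul_of_pos_left (res_lt hp n i) (by omega)

lemma repunit_mul_sum_dig {p : ℕ} (hp : 2 ≤ p) (n : ℕ) :
    repunit p * ∑ i, dig p n i = ∑ i, res p n i := by
  have h : ∑ i, p * res p n i = ∑ i, (modulus p * dig p n i + res p n (i + 1)) :=
    Finset.sum_congr rfl fun i _ => mul_res hp n i
  rw [Finset.sum_add_distrib, ← Finset.mul_sum, ← Finset.mul_sum,
    show ∑ i, res p n (i + 1) = ∑ i, res p n i from
      Equiv.sum_comp (Equiv.addRight (1 : Fin 5)) (res p n), modulus] at h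
  obtain ⟨q, rfl⟩ : ∃ q, p = q + 1 := ⟨p - 1, by omega⟩
  have hq : 0 < q := by omega
  simp only [Nat.add_sub_cancel] at h
  apply Nat.eq_of_mul_eq_mul_left hq
  nlinarith

lemma res_eq_sum_dig {p : ℕ} (hp : 2 ≤ p) (n : ℕ) (i : Fin 5) :
    res p n i = dig p n i * p ^ 4 + dig p n (i + 1) * p ^ 3 + dig p n (i + 2) * p ^ 2
      + dig p n (i + 3) * p + dig p n (i + 4) := by
  have h0 := mul_res hp n i
  have h1 := mul_res hp n (i + 1)
  have h2 := mul_res hp n (i + 2)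
  have h3 := mul_res hp n (i + 3)
  have h4 := mul_res hp n (i + 4)
  simp only [add_assoc] at h1 h2 h3 h4
  rw [show (1 : Fin 5) + 1 = 2 from rfl] at h1
  rw [show (2 : Fin 5) + 1 = 3 from rfl] at h2
  rw [show (3 : Fin 5) + 1 = 4 from rfl] at h3
  rw [show (4 : Fin 5) + 1 = 0 from rfl, add_zero] at h4
  apply Nat.eq_of_mul_eq_mul_left (modulus_pos hp)
  have key : p ^ 5 * res p n i = modulus p * (dig p n i * p ^ 4 + dig p n (i + 1) * p ^ 3 +
      dig p n (i + 2) * p ^ 2 + dig p n (i + 3) * p + dig p n (i + 4)) + res p n i := by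
    calc p ^ 5 * res p n i = p ^ 4 * (p * res p n i) := by ring
      _ = p ^ 4 * (modulus p * dig p n i) + p ^ 3 * (p * res p n (i + 1)) := by rw [h0]; ring
      _ = p ^ 4 * (modulus p * dig p n i) + p ^ 3 * (modulus p * dig p n (i + 1)) +
          p ^ 2 * (p * res p n (i + 2)) := by rw [h1]; ring
      _ = p ^ 4 * (modulus p * dig p n i) + p ^ 3 * (modulus p * dig p n (i + 1)) +
          p ^ 2 * (modulus p * dig p n (i + 2)) + p * (p * res p n (i + 3)) := by rw [h2]; ring
      _ = p ^ 4 * (modulus p * dig p n i) + p ^ 3 * (modulus p * dig p n (i + 1)) +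
          p ^ 2 * (modulus p * dig p n (i + 2)) + p * (modulus p * dig p n (i + 3)) +
          p * res p n (i + 4) := by rw [h3]; ring
      _ = _ := by rw [h4]; ring
  rw [← modulus_add_one hp] at key
  linarith

lemma sum_dig_of_eq {p : ℕ} (hp : 2 ≤ p) {n e₀ e₁ e₂ e₃ e₄ : ℕ}
    (h₀ : e₀ < p) (h₁ : e₁ < p) (h₂ : e₂ < p) (h₃ : e₃ < p) (h₄ : e₄ < p)
    (hlt : e₀ + e₁ + e₂ + e₃ + e₄ < 5 * (p - 1))
    (hn : n ≡ e₀ * p ^ 4 + e₁ * p ^ 3 + e₂ * p ^ 2 + e₃ * p + e₄ [MOD modulus p]) :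
    ∑ i, dig p n i = e₀ + e₁ + e₂ + e₃ + e₄ := by
  have hbound : ∀ a b c d e : ℕ, a < p → b < p → c < p → d < p → e < p →
      a + b + c + d + e < 5 * (p - 1) →
      a * p ^ 4 + b * p ^ 3 + c * p ^ 2 + d * p + e < modulus p := by
    obtain ⟨q, rfl⟩ : ∃ q, p = q + 1 := ⟨p - 1, by omega⟩
    intro a b c d e ha hb hc hd he hs
    simp only [Nat.add_sub_cancel] at hs
    have ha := Nat.mul_le_mul_right ((q+1)^4) (Nat.le_of_lt_succ ha)
    have hb := Nat.mul_le_mul_right ((q+1)^3) (Nat.le_of_lt_succ hb)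
    have hc := Nat.mul_le_mul_right ((q+1)^2) (Nat.le_of_lt_succ hc)
    have hd := Nat.mul_le_mul_right (q+1) (Nat.le_of_lt_succ hd)
    have hN : modulus (q + 1) = q * (q+1)^4 + q * (q+1)^3 + q * (q+1)^2 + q * (q+1) + q := by
      simp only [modulus, repunit, Nat.add_sub_cancel]; ring
    rw [hN]
    by_contra hcon
    have h4 : 0 < (q+1)^4 := by positivity
    have h3 : 0 < (q+1)^3 := by positivity
    have h2 : 0 < (q+1)^2 := by positivity
    have ea : q * (q+1)^4 ≤ a * (q+1)^4 := by omega
    have eb : q * (q+1)^3 ≤ b * (q+1)^3 := by omega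
    have ec : q * (q+1)^2 ≤ c * (q+1)^2 := by omega
    have ed : q * (q+1) ≤ d * (q+1) := by omega
    have ea := Nat.le_of_mul_le_mul_right ea h4
    have eb := Nat.le_of_mul_le_mul_right eb h3
    have ec := Nat.le_of_mul_le_mul_right ec h2
    have ed := Nat.le_of_mul_le_mul_right ed (by omega)
    omega
  have hrot : ∀ m a b c d e : ℕ,
      m ≡ a * p ^ 4 + b * p ^ 3 + c * p ^ 2 + d * p + e [MOD modulus p] →
      p * m ≡ b * p ^ 4 + c * p ^ 3 + d * p ^ 2 + e * p + a [MOD modulus p] := by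
    intro m a b c d e hm
    refine (hm.mul_left p).trans ?_
    have := ((pow_five_modEq hp).mul_left a).add_left (b * p ^ 4 + c * p ^ 3 + d * p ^ 2 + e * p)
    rw [mul_one] at this
    convert this using 1
    ring
  have n1 := hrot _ _ _ _ _ _ hn
  have n2 := hrot _ _ _ _ _ _ n1
  have n3 := hrot _ _ _ _ _ _ n2
  have n4 := hrot _ _ _ _ _ _ n3
  have r : ∀ m a b c d e : ℕ, a < p → b < p → c < p → d < p → e < p →
      a + b + c + d + e < 5 * (p - 1) →
      m ≡ a * p ^ 4 + b * p ^ 3 + c * p ^ 2 + d * p + e [MOD modulus p] →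
      m % modulus p = a * p ^ 4 + b * p ^ 3 + c * p ^ 2 + d * p + e := by
    intro m a b c d e ha hb hc hd he hs hm
    rw [hm, Nat.mod_eq_of_lt (hbound a b c d e ha hb hc hd he hs)]
  have R0 : res p n 0 = e₀ * p ^ 4 + e₁ * p ^ 3 + e₂ * p ^ 2 + e₃ * p + e₄ := by
    rw [← r _ _ _ _ _ _ h₀ h₁ h₂ h₃ h₄ (by omega) hn, res]
    congr 1
    simp
  have R1 : res p n 1 = e₁ * p ^ 4 + e₂ * p ^ 3 + e₃ * p ^ 2 + e₄ * p + e₀ := by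
    rw [← r _ _ _ _ _ _ h₁ h₂ h₃ h₄ h₀ (by omega) n1, res]
    congr 1
    simp
  have R2 : res p n 2 = e₂ * p ^ 4 + e₃ * p ^ 3 + e₄ * p ^ 2 + e₀ * p + e₁ := by
    rw [← r _ _ _ _ _ _ h₂ h₃ h₄ h₀ h₁ (by omega) n2, res]
    congr 1
    simp; ring
  have R3 : res p n 3 = e₃ * p ^ 4 + e₄ * p ^ 3 + e₀ * p ^ 2 + e₁ * p + e₂ := by
    rw [← r _ _ _ _ _ _ h₃ h₄ h₀ h₁ h₂ (by omega) n3, res]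
    congr 1
    simp; ring
  have R4 : res p n 4 = e₄ * p ^ 4 + e₀ * p ^ 3 + e₁ * p ^ 2 + e₂ * p + e₃ := by
    rw [← r _ _ _ _ _ _ h₄ h₀ h₁ h₂ h₃ (by omega) n4, res]
    congr 1
    simp; ring
  apply Nat.eq_of_mul_eq_mul_left (repunit_pos p)
  rw [repunit_mul_sum_dig hp, Fin.sum_univ_five, R0, R1, R2, R3, R4, repunit]
  ring

lemma modEq_of_cast_eq {p : ℕ} (hp : 2 ≤ p) {a b : ℕ} (k : ℤ)
    (h : (a : ℤ) = b + k * ((p : ℤ) ^ 5 - 1)) : a ≡ b [MOD modulus p] := by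
  have hN : (modulus p : ℤ) = (p : ℤ) ^ 5 - 1 := by
    have := modulus_add_one hp
    rw [eq_sub_iff_add_eq]; exact_mod_cast this
  refine (Nat.modEq_iff_dvd.2 ⟨-k, ?_⟩)
  rw [hN, h]; ring

lemma sum_dig_pow_mul {p : ℕ} (hp : 2 ≤ p) (n : ℕ) (j : Fin 5) :
    ∑ i, dig p (p ^ (j : ℕ) * n) i = ∑ i, dig p n i := by
  simp only [← dig_add hp]
  exact Equiv.sum_comp (Equiv.addRight j) (dig p n)

lemma sum_dig_swap_ne {p : ℕ} (hp : 2 ≤ p) {x y u n m : ℕ} (hx : 1 ≤ x) (hxy : x < y)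
    (hy : y < p) (hu : (u : ℤ) = (p : ℤ) ^ 4 - (p : ℤ) ^ 2 + 1)
    (hn : n ≡ x * p ^ 2 + y [MOD modulus p]) (hm : m ≡ y * p ^ 2 + x [MOD modulus p]) :
    ∑ i, dig p (u * n) i ≠ ∑ i, dig p (u * m) i := by
  have e1 : ∑ i, dig p (u * m) i = (p + x - y) + 0 + (y - x) + y + (x - 1) := by
    refine sum_dig_of_eq hp (by omega) (by omega) (by omega) (by omega) (by omega) (by omega)
      ((hm.mul_left u).trans (modEq_of_cast_eq hp (y * p - 1) ?_))
    push_cast [hu, Nat.cast_sub hx, Nat.cast_sub hxy.le, Nat.cast_sub (show y ≤ p + x by omega)]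
    ring
  have e2 : ∑ i, dig p (p ^ ((3 : Fin 5) : ℕ) * (u * n)) i =
      x + y + (y - x - 1) + (p - 1) + (p + x - y) := by
    refine sum_dig_of_eq hp (by omega) (by omega) (by omega) (by omega) (by omega) (by omega)
      (((hn.mul_left u).mul_left _).trans (modEq_of_cast_eq hp (y * p ^ 2 - y + u * x) ?_))
    push_cast [hu, Nat.cast_sub (show 1 ≤ y - x by omega), Nat.cast_sub hxy.le,
      Nat.cast_sub (show y ≤ p + x by omega), Nat.cast_sub (show 1 ≤ p by omega),
      show ((3 : Fin 5) : ℕ) = 3 from rfl]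
    ring
  rw [sum_dig_pow_mul hp] at e2
  omega

lemma sum_dig_shift_one_ne {p : ℕ} (hp : 2 ≤ p) {x y t n m : ℕ} (hxy : x < y)
    (hy : y < p) (ht : (t : ℤ) = (p : ℤ) ^ 2 - p + 1)
    (hn : n ≡ y * p ^ 4 + p ^ 3 + x [MOD modulus p])
    (hm : m ≡ y * p ^ 4 + p ^ 2 + x [MOD modulus p]) :
    ∑ i, dig p (t * n) i ≠ ∑ i, dig p (t * m) i := by
  have e1 : ∑ i, dig p (p ^ ((4 : Fin 5) : ℕ) * (t * m)) i =
      (p + x - y) + y + (p - 1) + (x + 1) + (y - x - 1) := by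
    refine sum_dig_of_eq hp (by omega) (by omega) (by omega) (by omega) (by omega) (by omega)
      (((hm.mul_left t).mul_left _).trans
        (modEq_of_cast_eq hp (y - x - 1 + x * p + t * (y * p ^ 3 + p)) ?_))
    push_cast [ht, Nat.cast_sub (show 1 ≤ y - x by omega), Nat.cast_sub hxy.le,
      Nat.cast_sub (show y ≤ p + x by omega), Nat.cast_sub (show 1 ≤ p by omega),
      show ((4 : Fin 5) : ℕ) = 4 from rfl]
    ring
  rw [sum_dig_pow_mul hp] at e1
  rcases Nat.eq_or_lt_of_le (Nat.succ_le_of_lt hxy) with rfl | h2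
  · have e2 : ∑ i, dig p (p ^ ((4 : Fin 5) : ℕ) * (t * n)) i = 0 + x + 1 + x + 1 := by
      refine sum_dig_of_eq hp (by omega) (by omega) (by omega) (by omega) (by omega) (by omega)
        (((hn.mul_left t).mul_left _).trans
          (modEq_of_cast_eq hp (1 + x * p + t * ((x + 1) * p ^ 3 + p ^ 2)) ?_))
      push_cast [ht, show ((4 : Fin 5) : ℕ) = 4 from rfl]
      ring
    rw [sum_dig_pow_mul hp] at e2
    omega
  · have e2 : ∑ i, dig p (p ^ ((4 : Fin 5) : ℕ) * (t * n)) i =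
        (p + x + 1 - y) + (y - 1) + 1 + x + (y - x - 1) := by
      refine sum_dig_of_eq hp (by omega) (by omega) (by omega) (by omega) (by omega) (by omega)
        (((hn.mul_left t).mul_left _).trans
          (modEq_of_cast_eq hp (y - x - 1 + x * p + t * (y * p ^ 3 + p ^ 2)) ?_))
      push_cast [ht, Nat.cast_sub (show 1 ≤ y - x by omega), Nat.cast_sub hxy.le,
        Nat.cast_sub (show y ≤ p + x + 1 by omega), Nat.cast_sub (show 1 ≤ y by omega),
        show ((4 : Fin 5) : ℕ) = 4 from rfl]
      ring
    rw [sum_dig_pow_mul hp] at e2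
    omega

lemma sum_dig_shift_two_ne {p : ℕ} (hp : 2 ≤ p) {y t n m : ℕ} (hy0 : 1 ≤ y)
    (hy : y < p) (ht : (t : ℤ) = (p : ℤ) ^ 2 - p + 1)
    (hn : n ≡ y * p ^ 4 + p ^ 3 [MOD modulus p])
    (hm : m ≡ y * p ^ 4 + p [MOD modulus p]) :
    ∑ i, dig p (t * n) i ≠ ∑ i, dig p (t * m) i := by
  have e1 : ∑ i, dig p (t * m) i = y + 0 + (p - 1) + y + (p - y) := by
    refine sum_dig_of_eq hp (by omega) (by omega) (by omega) (by omega) (by omega) (by omega)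
      ((hm.mul_left t).trans (modEq_of_cast_eq hp (y * p - y) ?_))
    push_cast [ht, Nat.cast_sub hy.le, Nat.cast_sub (show 1 ≤ p by omega)]
    ring
  rcases Nat.eq_or_lt_of_le hy0 with rfl | h2
  · have e2 : ∑ i, dig p (t * n) i = 0 + 1 + 0 + 1 + 0 := by
      refine sum_dig_of_eq hp (by omega) (by omega) (by omega) (by omega) (by omega) (by omega)
        ((hn.mul_left t).trans (modEq_of_cast_eq hp p ?_))
      push_cast [ht]
      ring
    omega
  · have e2 : ∑ i, dig p (t * n) i = (y - 1) + 1 + 0 + (y - 1) + (p + 1 - y) := by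
      refine sum_dig_of_eq hp (by omega) (by omega) (by omega) (by omega) (by omega) (by omega)
        ((hn.mul_left t).trans (modEq_of_cast_eq hp (y * p - y + 1) ?_))
      push_cast [ht, Nat.cast_sub hy0, Nat.cast_sub (show y ≤ p + 1 by omega)]
      ring
    omega

lemma coprime_modulus_of_mul {p a b c : ℕ} (hp : 2 ≤ p)
    (h : (a : ℤ) * b = (p : ℤ) ^ 3 + c * ((p : ℤ) ^ 5 - 1)) :
    Nat.Coprime a (modulus p) := by
  have h1 : a * b ≡ p ^ 3 [MOD modulus p] :=
    modEq_of_cast_eq hp c (by push_cast; exact h)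
  have h2 : p ^ 2 * (a * b) ≡ 1 [MOD modulus p] := by
    refine (h1.mul_left (p ^ 2)).trans ?_
    rw [← pow_add]; exact pow_five_modEq hp
  have h3 : Nat.Coprime (p ^ 2 * (a * b)) (modulus p) := by
    rw [Nat.Coprime, h2.gcd_eq]; simp
  exact (h3.coprime_mul_left).coprime_mul_right

lemma exists_coprime_multiplier_two {p : ℕ} (hp : 2 ≤ p) :
    ∃ t : ℕ, (t : ℤ) = (p : ℤ) ^ 2 - p + 1 ∧ Nat.Coprime t (modulus p) := by
  have h1 : (((p ^ 2 - p + 1 : ℕ)) : ℤ) = (p : ℤ) ^ 2 - p + 1 := by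
    push_cast [Nat.cast_sub (show p ≤ p ^ 2 by nlinarith)]; ring
  have h2 : (((p ^ 4 - p ^ 2 + 1 : ℕ)) : ℤ) = (p : ℤ) ^ 4 - (p : ℤ) ^ 2 + 1 := by
    push_cast [Nat.cast_sub (show p ^ 2 ≤ p ^ 4 from Nat.pow_le_pow_right (by omega) (by omega))]
    ring
  refine ⟨_, h1, coprime_modulus_of_mul (b := p ^ 4 - p ^ 2 + 1) (c := p - 1) hp ?_⟩
  rw [h1, h2]; push_cast [Nat.cast_sub (show 1 ≤ p by omega)]; ring

lemma exists_coprime_multiplier_four {p : ℕ} (hp : 2 ≤ p) :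
    ∃ u : ℕ, (u : ℤ) = (p : ℤ) ^ 4 - (p : ℤ) ^ 2 + 1 ∧ Nat.Coprime u (modulus p) := by
  have h1 : (((p ^ 2 - p + 1 : ℕ)) : ℤ) = (p : ℤ) ^ 2 - p + 1 := by
    push_cast [Nat.cast_sub (show p ≤ p ^ 2 by nlinarith)]; ring
  have h2 : (((p ^ 4 - p ^ 2 + 1 : ℕ)) : ℤ) = (p : ℤ) ^ 4 - (p : ℤ) ^ 2 + 1 := by
    push_cast [Nat.cast_sub (show p ^ 2 ≤ p ^ 4 from Nat.pow_le_pow_right (by omega) (by omega))]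
    ring
  refine ⟨_, h2, coprime_modulus_of_mul (b := p ^ 2 - p + 1) (c := p - 1) hp ?_⟩
  rw [h1, h2]; push_cast [Nat.cast_sub (show 1 ≤ p by omega)]; ring

/-- The quotient of `res p n i` by the repunit `1 + p + p ^ 2 + p ^ 3 + p ^ 4`. -/
def cell (p n : ℕ) (i : Fin 5) : ℕ := res p n i / repunit p

/-- The number of cyclic descents of the sequence of residues of `n`. -/
def numDrops (p n : ℕ) : ℕ :=
  (Finset.univ.filter fun i : Fin 5 => res p n (i + 1) < res p n i).card

lemma cell_lt {p : ℕ} (hp : 2 ≤ p) (n : ℕ) (i : Fin 5) : cell p n i < p - 1 := by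
  rw [cell, Nat.div_lt_iff_lt_mul (repunit_pos p)]
  exact res_lt hp n i

lemma dig_eq_cell_add {p : ℕ} (hp : 2 ≤ p) (n : ℕ) (i : Fin 5) :
    dig p n i = cell p n i + if res p n (i + 1) < res p n i then 1 else 0 := by
  have h := mul_res hp n i
  have hR' := res_lt hp n (i + 1)
  have hR := res_lt hp n i
  have hs := Nat.mod_lt (res p n i) (repunit_pos p)
  have hd := Nat.div_add_mod (res p n i) (repunit p)
  change repunit p * cell p n i + _ = _ at hd
  obtain ⟨q, rfl⟩ : ∃ q, p = q + 1 := ⟨p - 1, by omega⟩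
  have hN : modulus (q + 1) = q * repunit (q + 1) := by simp [modulus]
  generalize repunit (q + 1) = M at *
  generalize modulus (q + 1) = N at *
  generalize res (q + 1) n i = R at *
  generalize res (q + 1) n (i + 1) = R' at *
  generalize R % M = s at *
  generalize cell (q + 1) n i = c at *
  generalize dig (q + 1) n i = d at *
  have hqs : q * s < N := by
    rw [hN]; exact Nat.mul_lt_mul_of_pos_left hs (by omega)
  have key : N * c + q * s + R = N * d + R' := by
    rw [← h, hN, ← hd]; ring
  clear h hd hs hN
  split_ifs with hlt
  · have h1 : c < d := by
      by_contra! hc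
      have := Nat.mul_le_mul_left N hc
      omega
    have h2 : d < c + 2 := by
      by_contra! hc
      have := Nat.mul_le_mul_left N hc
      rw [mul_add] at this
      omega
    omega
  · have h1 : c < d + 1 := by
      by_contra! hc
      have := Nat.mul_le_mul_left N hc
      rw [mul_add] at this
      omega
    have h2 : d < c + 1 := by
      by_contra! hc
      have := Nat.mul_le_mul_left N hc
      rw [mul_add] at this
      omega
    omega

lemma sum_dig_eq_sum_cell_add {p : ℕ} (hp : 2 ≤ p) (n : ℕ) :
    ∑ i, dig p n i = ∑ i, cell p n i + numDrops p n := by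
  simp only [dig_eq_cell_add hp, Finset.sum_add_distrib, numDrops, Finset.card_filter]

lemma repunit_mul_numDrops {p : ℕ} (hp : 2 ≤ p) (n : ℕ) :
    repunit p * numDrops p n = ∑ i : Fin 5, n * p ^ (i : ℕ) % repunit p := by
  have h := repunit_mul_sum_dig hp n
  rw [sum_dig_eq_sum_cell_add hp] at h
  have h2 : ∑ i, res p n i = ∑ i : Fin 5, (repunit p * cell p n i + n * p ^ (i : ℕ) % repunit p) := by
    refine Finset.sum_congr rfl fun i _ => ?_
    rw [← Nat.mod_mul_left_mod (n * p ^ (i : ℕ)) (p - 1) (repunit p), mul_comm n]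
    exact (Nat.div_add_mod _ _).symm
  rw [h2, Finset.sum_add_distrib, ← Finset.mul_sum, mul_add] at h
  omega

lemma numDrops_add_mul_repunit {p : ℕ} (hp : 2 ≤ p) (n k : ℕ) :
    numDrops p (n + k * repunit p) = numDrops p n := by
  apply Nat.eq_of_mul_eq_mul_left (repunit_pos p)
  rw [repunit_mul_numDrops hp, repunit_mul_numDrops hp]
  refine Finset.sum_congr rfl fun i _ => ?_
  rw [show (n + k * repunit p) * p ^ (i : ℕ) = n * p ^ (i : ℕ) + k * p ^ (i : ℕ) * repunit p by ring,
    Nat.add_mul_mod_self_right]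

lemma res_shift {p : ℕ} (hp : 2 ≤ p) (n : ℕ) {r : ℕ} (hr : r ≤ p - 1) (i : Fin 5) :
    res p (n + (p - 1 - r) * repunit p) i =
      if cell p n i < r then res p n i + (p - 1 - r) * repunit p
      else res p n i - r * repunit p := by
  have hmod : res p (n + (p - 1 - r) * repunit p) i ≡
      res p n i + (p - 1 - r) * repunit p [MOD modulus p] := by
    refine (res_modEq p _ i).trans ?_
    rw [mul_add]
    refine (res_modEq p n i).symm.add ?_
    have := (mul_repunit_modEq hp i).mul_left (p - 1 - r)
    rwa [mul_left_comm] at this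
  have hN : modulus p = r * repunit p + (p - 1 - r) * repunit p := by
    rw [← add_mul, modulus]; congr 1; omega
  have hlt := res_lt hp (n + (p - 1 - r) * repunit p) i
  have hR := res_lt hp n i
  have hc : cell p n i < r ↔ res p n i < r * repunit p :=
    Nat.div_lt_iff_lt_mul (repunit_pos p)
  simp only [hc]
  rw [← Nat.mod_eq_of_lt hlt, hmod]
  split_ifs with h
  · exact Nat.mod_eq_of_lt (by omega)
  · rw [Nat.mod_eq_sub_mod (by omega), Nat.mod_eq_of_lt (by omega)]
    omega

/-- The effect of a cyclic shift by `r` on a value in `[0, p - 1)`. -/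
def cutShift (p r c : ℕ) : ℕ := if c < r then c + (p - 1 - r) else c - r

lemma cell_shift {p : ℕ} (hp : 2 ≤ p) (n : ℕ) {r : ℕ} (hr : r ≤ p - 1) (i : Fin 5) :
    cell p (n + (p - 1 - r) * repunit p) i = cutShift p r (cell p n i) := by
  rw [cell, res_shift hp n hr, cutShift]
  split_ifs with h
  · rw [Nat.add_mul_div_right _ _ (repunit_pos p)]; rfl
  · rw [mul_comm, Nat.sub_mul_div]; rfl

lemma cutShift_lt {p r c : ℕ} (hc : c < p - 1) : cutShift p r c < p - 1 := by
  unfold cutShift; split_ifs <;> omega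

lemma cutShift_inj {p r c d : ℕ} (hr : r ≤ p - 1) (hc : c < p - 1) (hd : d < p - 1)
    (h : cutShift p r c = cutShift p r d) : c = d := by
  unfold cutShift at h; split_ifs at h <;> omega

/-- The position of `j` in the cyclic order of `Fin 5` that starts just after `m`. -/
def cutKey (m j : Fin 5) : Fin 5 := j + 4 - m

/-- Whether the cyclic sequence `A` descends at `i`, for the order starting just after `m`. -/
def isDrop (A : Fin 5 → Fin 5) (m i : Fin 5) : Bool :=
  decide (cutKey m (A (i + 1)) < cutKey m (A i))

lemma cutKey_lt_iff : ∀ m x y : Fin 5, cutKey m x < cutKey m y ↔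
    if x ≤ m then (if y ≤ m then x < y else False) else (if y ≤ m then True else x < y) := by
  decide

lemma cutKey_four : ∀ x : Fin 5, cutKey 4 x = x := by decide

lemma cutKey_lt_self : ∀ m x : Fin 5, x ≠ m → cutKey m x < cutKey m m := by decide

lemma exists_rank {f : Fin 5 → ℕ} (hf : Function.Injective f) :
    ∃ A : Fin 5 → Fin 5, Function.Bijective A ∧ ∀ i k, A i < A k ↔ f i < f k := by
  have hlt : ∀ i, (Finset.univ.filter fun k => f k < f i).card < 5 := fun i =>
    Finset.card_lt_univ_of_notMem (x := i) (by simp)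
  have hmono : ∀ i k, f i < f k →
      (Finset.univ.filter fun l => f l < f i).card < (Finset.univ.filter fun l => f l < f k).card := by
    intro i k hik
    apply Finset.card_lt_card
    rw [Finset.ssubset_iff_of_subset]
    · exact ⟨i, by simpa using hik, by simp⟩
    · intro l; simp only [Finset.mem_filter, Finset.mem_univ, true_and]; omega
  have key : ∀ i k, (⟨_, hlt i⟩ : Fin 5) < ⟨_, hlt k⟩ ↔ f i < f k := by
    intro i k
    rw [Fin.mk_lt_mk]
    refine ⟨fun h => ?_, hmono i k⟩
    by_contra! hc
    rcases hc.lt_or_eq with h1 | h1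
    · exact absurd (hmono k i h1) (by omega)
    · rw [hf h1] at h; exact lt_irrefl _ h
  refine ⟨fun i => ⟨_, hlt i⟩, Finite.injective_iff_bijective.1 fun i k h => ?_, key⟩
  by_contra hne
  rcases lt_or_gt_of_ne (hf.ne hne) with h1 | h1
  · exact ((key i k).2 h1).ne h
  · exact ((key k i).2 h1).ne h.symm

lemma lt_iff_isDrop_shift {p : ℕ} (hp : 2 ≤ p) {n r : ℕ} (hr : r ≤ p - 1)
    {A : Fin 5 → Fin 5} (hA : ∀ i k, A i < A k ↔ res p n i < res p n k) {m : Fin 5}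
    (hm : ∀ i, cell p n i < r ↔ A i ≤ m) (i : Fin 5) :
    res p (n + (p - 1 - r) * repunit p) (i + 1) < res p (n + (p - 1 - r) * repunit p) i ↔
      isDrop A m i = true := by
  have hN : modulus p = r * repunit p + (p - 1 - r) * repunit p := by
    rw [← add_mul, modulus]; congr 1; omega
  rw [isDrop, decide_eq_true_iff, cutKey_lt_iff, res_shift hp n hr, res_shift hp n hr]
  simp only [← hm, hA]
  have h0 := res_lt hp n i
  have h1 := res_lt hp n (i + 1)
  have c0 : cell p n i < r ↔ res p n i < r * repunit p :=
    Nat.div_lt_iff_lt_mul (repunit_pos p)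
  have c1 : cell p n (i + 1) < r ↔ res p n (i + 1) < r * repunit p :=
    Nat.div_lt_iff_lt_mul (repunit_pos p)
  simp only [c0, c1]
  split_ifs <;> (try simp only [iff_false, iff_true]) <;> omega

lemma lt_iff_lt_card_of_monotone {C : Fin 5 → ℕ} (hC : Monotone C) (r : ℕ) (j : Fin 5) :
    C j < r ↔ (j : ℕ) < (Finset.univ.filter fun k => C k < r).card := by
  constructor
  · intro h
    have : Finset.Iic j ⊆ Finset.univ.filter fun k => C k < r := by
      intro k hk
      simp only [Finset.mem_Iic] at hk
      simpa using (hC hk).trans_lt h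
    have := Finset.card_le_card this
    rw [Fin.card_Iic] at this
    omega
  · intro h
    by_contra! hc
    have : (Finset.univ.filter fun k => C k < r) ⊆ Finset.Iio j := by
      intro k hk
      simp only [Finset.mem_filter, Finset.mem_univ, true_and] at hk
      rw [Finset.mem_Iio]
      by_contra! hjk
      exact absurd (hC hjk) (by omega)
    have := Finset.card_le_card this
    rw [Fin.card_Iio] at this
    omega

/-- The least element of the class of `j`, where `t j` says that `j` and `j + 1` are equivalent. -/
def classRep (t : Fin 5 → Bool) : Fin 5 → Fin 5 :=
  let r₁ : Fin 5 := if t 0 then 0 else 1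
  let r₂ : Fin 5 := if t 1 then r₁ else 2
  let r₃ : Fin 5 := if t 2 then r₂ else 3
  let r₄ : Fin 5 := if t 3 then r₃ else 4
  ![0, r₁, r₂, r₃, r₄]

/-- Compatibility of a ranking `A` with the ties `t`. -/
def TieCompatible (A : Fin 5 → Fin 5) (t : Fin 5 → Bool) : Prop :=
  ∀ i k, t (A i) = true → A k = A i + 1 →
    (isDrop A 4 i = false ∧ isDrop A 4 k = true) ∨
      (isDrop A 4 i = isDrop A 4 k ∧ A (i + 1) < A (k + 1))

instance (A t) : Decidable (TieCompatible A t) := by unfold TieCompatible; infer_instance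

/-- Rank `x` is the start of a descent of `A`, for the order starting just after `m`. -/
def isDropRank (A : Fin 5 → Fin 5) (m x : Fin 5) : Prop := ∃ i, A i = x ∧ isDrop A m i = true

instance (A m x) : Decidable (isDropRank A m x) := by unfold isDropRank; infer_instance

/-- The constraint imposed on two rankings by the cut after rank `m`. -/
def CutCompatible (A B : Fin 5 → Fin 5) (t : Fin 5 → Bool) (m : Fin 5) : Prop :=
  t m = false → ∀ x y, isDropRank A m x → ¬ isDropRank B m x → isDropRank B m y →
    ¬ isDropRank A m y → classRep t x = classRep t y

instance (A B t m) : Decidable (CutCompatible A B t m) := by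
  unfold CutCompatible; infer_instance

/-- The number of descents of the cyclic sequence `A`. -/
def dropCount (A : Fin 5 → Fin 5) : ℕ := ∑ i, if isDrop A 4 i then 1 else 0

/-- The number of elements in the class of `x`. -/
def classSize (t : Fin 5 → Bool) (x : Fin 5) : ℕ :=
  ∑ j, if classRep t j = classRep t x then 1 else 0

/-- The symbolic digit at `i`: a class together with a carry. -/
def symDigit (A : Fin 5 → Fin 5) (t : Fin 5 → Bool) (i : Fin 5) : Fin 5 × Bool :=
  (classRep t (A i), isDrop A 4 i)

/-- The exceptional pairs of symbolic digit vectors. -/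
def IsExceptional (a b : Fin 5 → Fin 5 × Bool) : Prop :=
  (a 0 = (0, false) ∧ a 1 = (0, false) ∧ (a 2).2 = true ∧ a 3 = (0, false) ∧ (a 4).2 = true ∧
    b 0 = (0, false) ∧ b 1 = (0, false) ∧ b 2 = a 4 ∧ b 3 = (0, false) ∧ b 4 = a 2) ∨
  (b 0 = a 0 ∧ (a 0).2 = true ∧ a 4 = b 4 ∧ (a 4).2 = false ∧ (a 4).1 ≤ (a 0).1 ∧
    a 1 = (0, true) ∧ a 2 = (0, false) ∧ a 3 = (0, false) ∧
    b 1 = (0, false) ∧ b 2 = (0, true) ∧ b 3 = (0, false)) ∨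
  (b 0 = a 0 ∧ (a 0).2 = true ∧
    a 1 = (0, true) ∧ a 2 = (0, false) ∧ a 3 = (0, false) ∧ a 4 = (0, false) ∧
    b 1 = (0, false) ∧ b 2 = (0, false) ∧ b 3 = (0, true) ∧ b 4 = (0, false))

instance (a b) : Decidable (IsExceptional a b) := by unfold IsExceptional; infer_instance

/-- The possible relations between two compatible symbolic digit vectors. -/
def Outcome (a b : Fin 5 → Fin 5 × Bool) : Prop :=
  (∃ j, ∀ i, a i = b (i + j)) ∨
    ∃ j k, IsExceptional (fun i => a (i + j)) (fun i => b (i + k)) ∨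
      IsExceptional (fun i => b (i + k)) (fun i => a (i + j))

instance (a b) : Decidable (Outcome a b) := by unfold Outcome; infer_instance

/-- A normalised ranking with at most two descents. -/
def IsNormalized (A : Fin 5 → Fin 5) : Prop :=
  (∀ i j, i < j → A i ≠ A j) ∧ dropCount A ≤ 2

instance (A) : Decidable (IsNormalized A) := by unfold IsNormalized; infer_instance

set_option maxRecDepth 100000 in
lemma outcome_aux : ∀ a₁ a₂ a₃ a₄ : Fin 5, IsNormalized ![0, a₁, a₂, a₃, a₄] →
    ∀ t₀ t₁ t₂ t₃ : Bool, TieCompatible ![0, a₁, a₂, a₃, a₄] ![t₀, t₁, t₂, t₃, false] →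
    (∀ x, classSize ![t₀, t₁, t₂, t₃, false] x ≤ classSize ![t₀, t₁, t₂, t₃, false] 0) →
    ∀ b₁ b₂ b₃ b₄ : Fin 5, IsNormalized ![0, b₁, b₂, b₃, b₄] →
    dropCount ![0, b₁, b₂, b₃, b₄] = dropCount ![0, a₁, a₂, a₃, a₄] →
    TieCompatible ![0, b₁, b₂, b₃, b₄] ![t₀, t₁, t₂, t₃, false] →
    (∀ m, CutCompatible ![0, a₁, a₂, a₃, a₄] ![0, b₁, b₂, b₃, b₄] ![t₀, t₁, t₂, t₃, false] m) →
    Outcome (symDigit ![0, a₁, a₂, a₃, a₄] ![t₀, t₁, t₂, t₃, false])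
      (symDigit ![0, b₁, b₂, b₃, b₄] ![t₀, t₁, t₂, t₃, false]) := by
  decide +kernel

lemma outcome {A B : Fin 5 → Fin 5} {t : Fin 5 → Bool} (hA : A.Injective) (hB : B.Injective)
    (hA0 : A 0 = 0) (hB0 : B 0 = 0) (ht : t 4 = false) (hdA : dropCount A ≤ 2)
    (hdB : dropCount B = dropCount A) (htA : TieCompatible A t) (htB : TieCompatible B t)
    (hsize : ∀ x, classSize t x ≤ classSize t 0) (hcut : ∀ m, CutCompatible A B t m) :
    Outcome (symDigit A t) (symDigit B t) := by
  have eA : A = ![0, A 1, A 2, A 3, A 4] := by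
    funext i; fin_cases i <;> simp [hA0]
  have eB : B = ![0, B 1, B 2, B 3, B 4] := by
    funext i; fin_cases i <;> simp [hB0]
  have et : t = ![t 0, t 1, t 2, t 3, false] := by
    funext i; fin_cases i <;> simp [ht]
  have nA : IsNormalized A := ⟨fun i j h => hA.ne h.ne, hdA⟩
  have nB : IsNormalized B := ⟨fun i j h => hB.ne h.ne, hdB.trans_le hdA⟩
  have := outcome_aux (A 1) (A 2) (A 3) (A 4)
  rw [← eA] at this
  have := this nA (t 0) (t 1) (t 2) (t 3)
  rw [← et] at this
  have := this htA hsize (B 1) (B 2) (B 3) (B 4)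
  rw [← eB] at this
  exact this nB hdB htB hcut

/-- The residues `a` and `b` have the same digit sums and, modulo `p`, the same products of
factorials of digits, and so do all their unit multiples and twists. -/
def DigitData (p a b : ℕ) : Prop :=
  ∀ τ k : ℕ, Nat.Coprime τ (modulus p) →
    ∑ i, dig p (τ * (a + k * repunit p)) i = ∑ i, dig p (τ * (b + k * repunit p)) i ∧
    ((∏ i, (dig p (τ * (a + k * repunit p)) i).factorial : ℕ) : ZMod p) =
      (∏ i, (dig p (τ * (b + k * repunit p)) i).factorial : ℕ)

lemma classRep_spec {C : Fin 5 → ℕ} {t : Fin 5 → Bool}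
    (ht : ∀ j, j ≠ 4 → t j = true → C j = C (j + 1)) (j : Fin 5) : C (classRep t j) = C j := by
  have h0 := ht 0 (by decide)
  have h1 := ht 1 (by decide)
  have h2 := ht 2 (by decide)
  have h3 := ht 3 (by decide)
  fin_cases j
  · rfl
  all_goals
    simp only [classRep, Fin.reduceFinMk, Matrix.cons_val, Matrix.cons_val_one]
    split_ifs <;> simp_all

lemma classRep_eq_of_forall : ∀ t₀ t₁ t₂ t₃ t₄ : Bool, ∀ j k : Fin 5, j ≤ k →
    (∀ i, j ≤ i → i < k → ![t₀, t₁, t₂, t₃, t₄] i = true) →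
    classRep ![t₀, t₁, t₂, t₃, t₄] j = classRep ![t₀, t₁, t₂, t₃, t₄] k := by
  decide +kernel

lemma classRep_eq_iff {C : Fin 5 → ℕ} {t : Fin 5 → Bool} (hC : Monotone C)
    (ht : ∀ j, j ≠ 4 → (t j = true ↔ C j = C (j + 1))) (j k : Fin 5) :
    classRep t j = classRep t k ↔ C j = C k := by
  constructor
  · intro h
    rw [← classRep_spec (fun j hj => (ht j hj).1) j, h, classRep_spec fun j hj => (ht j hj).1]
  · intro h
    wlog hjk : j ≤ k generalizing j k
    · exact (this k j h.symm (le_of_not_ge hjk)).symm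
    have et : t = ![t 0, t 1, t 2, t 3, t 4] := by
      funext i; fin_cases i <;> rfl
    rw [et]
    refine classRep_eq_of_forall _ _ _ _ _ j k hjk fun i h1 h2 => ?_
    rw [← et]
    have h4 : i ≠ 4 := by rintro rfl; omega
    have h3 : i ≤ i + 1 ∧ i + 1 ≤ k := by
      revert h2 h4; clear * -; revert i k; decide
    exact (ht i h4).2 (le_antisymm (hC h3.1) ((hC h3.2).trans (h ▸ hC h1)))

lemma isDrop_four_iff {p n : ℕ} {A : Fin 5 → Fin 5}
    (hA : ∀ i k, A i < A k ↔ res p n i < res p n k) (i : Fin 5) :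
    isDrop A 4 i = true ↔ res p n (i + 1) < res p n i := by
  simp [isDrop, cutKey_four, hA]

lemma dropCount_eq {p n : ℕ} {A : Fin 5 → Fin 5}
    (hA : ∀ i k, A i < A k ↔ res p n i < res p n k) : dropCount A = numDrops p n := by
  simp only [dropCount, numDrops, Finset.card_filter, isDrop_four_iff hA]

lemma sum_cutShift (p r : ℕ) (c : Fin 5 → ℕ) (hr : r ≤ p - 1) :
    ∑ i, cutShift p r (c i) + 5 * r =
      ∑ i, c i + (p - 1) * (Finset.univ.filter fun i => c i < r).card := by
  have h : ∀ i, cutShift p r (c i) + r = c i + (p - 1) * if c i < r then 1 else 0 := by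
    intro i; unfold cutShift; split_ifs <;> simp <;> omega
  have := Finset.sum_congr (rfl : (Finset.univ : Finset (Fin 5)) = _) fun i _ => h i
  rw [Finset.sum_add_distrib, Finset.sum_add_distrib, ← Finset.mul_sum, ← Finset.card_filter] at this
  simpa using this

lemma DigitData.sum_eq {p a b : ℕ} (hp : 2 ≤ p) (h : DigitData p a b) {r : ℕ} (hr : r ≤ p - 1) :
    ∑ i, cutShift p r (cell p a i) + numDrops p a =
      ∑ i, cutShift p r (cell p b i) + numDrops p b := by
  have := (h 1 (p - 1 - r) (Nat.coprime_one_left _)).1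
  simpa only [one_mul, sum_dig_eq_sum_cell_add hp, cell_shift hp _ hr,
    numDrops_add_mul_repunit hp] using this

lemma DigitData.card_eq {p a b : ℕ} (hp : 2 ≤ p) (h : DigitData p a b) {r : ℕ}
    (hr : r ≤ p - 1) :
    (Finset.univ.filter fun i => cell p a i < r).card =
      (Finset.univ.filter fun i => cell p b i < r).card := by
  have h0 := h.sum_eq hp (Nat.zero_le (p - 1))
  have h1 := h.sum_eq hp hr
  have ha := sum_cutShift p r (cell p a) hr
  have hb := sum_cutShift p r (cell p b) hr
  simp only [cutShift, Nat.not_lt_zero, if_false, Nat.sub_zero] at h0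
  apply Nat.eq_of_mul_eq_mul_left (show 0 < p - 1 by omega)
  omega

lemma exists_monotone_cell {p n : ℕ} {A : Fin 5 → Fin 5} (hbij : A.Bijective)
    (hA : ∀ i k, A i < A k ↔ res p n i < res p n k) :
    ∃ C : Fin 5 → ℕ, Monotone C ∧ ∀ i, cell p n i = C (A i) := by
  let e := Equiv.ofBijective A hbij
  refine ⟨fun j => cell p n (e.symm j), fun j k hjk => ?_, fun i => ?_⟩
  · apply Nat.div_le_div_right
    rw [← not_lt, ← hA, not_lt]
    simpa [e, Equiv.ofBijective_apply_symm_apply] using hjk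
  · simp [e, Equiv.ofBijective_symm_apply_apply]

lemma card_filter_comp {A : Fin 5 → Fin 5} (hbij : A.Bijective) (P : Fin 5 → Prop)
    [DecidablePred P] :
    (Finset.univ.filter fun i => P (A i)).card = (Finset.univ.filter fun j => P j).card := by
  rw [Finset.card_filter, Finset.card_filter]
  exact hbij.sum_comp fun j => if P j then 1 else 0

lemma DigitData.exists_cells {p a b : ℕ} (hp : 2 ≤ p) (h : DigitData p a b)
    {A B : Fin 5 → Fin 5} (hAb : A.Bijective) (hBb : B.Bijective)
    (hA : ∀ i k, A i < A k ↔ res p a i < res p a k)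
    (hB : ∀ i k, B i < B k ↔ res p b i < res p b k) :
    ∃ C : Fin 5 → ℕ, Monotone C ∧ (∀ j, C j < p - 1) ∧ (∀ i, cell p a i = C (A i)) ∧
      ∀ i, cell p b i = C (B i) := by
  obtain ⟨C, hC, hCA⟩ := exists_monotone_cell hAb hA
  obtain ⟨D, hD, hDB⟩ := exists_monotone_cell hBb hB
  have lC : ∀ j, C j < p - 1 := fun j => by
    obtain ⟨i, rfl⟩ := hAb.2 j; rw [← hCA]; exact cell_lt hp _ _
  have lD : ∀ j, D j < p - 1 := fun j => by
    obtain ⟨i, rfl⟩ := hBb.2 j; rw [← hDB]; exact cell_lt hp _ _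
  have hlt : ∀ r ≤ p - 1, ∀ j, C j < r ↔ D j < r := by
    intro r hr j
    have := h.card_eq hp hr
    simp only [hCA, hDB] at this
    rw [card_filter_comp hAb fun j => C j < r, card_filter_comp hBb fun j => D j < r] at this
    rw [lt_iff_lt_card_of_monotone hC, lt_iff_lt_card_of_monotone hD, this]
  have hCD : C = D := by
    funext j
    have h1 := (hlt _ (lC j) j).1 (Nat.lt_succ_self _)
    have h2 := (hlt _ (lD j) j).2 (Nat.lt_succ_self _)
    omega
  exact ⟨C, hC, lC, hCA, hCD ▸ hDB⟩

lemma DigitData.numDrops_eq {p a b : ℕ} (hp : 2 ≤ p) (h : DigitData p a b)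
    {A B : Fin 5 → Fin 5} (hAb : A.Bijective) (hBb : B.Bijective) {C : Fin 5 → ℕ}
    (hA : ∀ i, cell p a i = C (A i)) (hB : ∀ i, cell p b i = C (B i)) :
    numDrops p a = numDrops p b := by
  have h0 := h.sum_eq hp (Nat.zero_le (p - 1))
  simp only [hA, hB] at h0
  rw [hAb.sum_comp fun j => cutShift p 0 (C j), hBb.sum_comp fun j => cutShift p 0 (C j)] at h0
  omega

lemma tieCompatible {p n : ℕ} (hp : 2 ≤ p) {A : Fin 5 → Fin 5}
    (hA : ∀ i k, A i < A k ↔ res p n i < res p n k) {C : Fin 5 → ℕ}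
    (hC : ∀ i, cell p n i = C (A i)) {t : Fin 5 → Bool}
    (ht : ∀ j, t j = true → j ≠ 4 ∧ C j = C (j + 1)) : TieCompatible A t := by
  intro i k hi hk
  obtain ⟨h4, hc⟩ := ht _ hi
  rw [← hk, ← hC, ← hC] at hc
  have hlt : A i < A k := by
    rw [hk]; revert h4; generalize A i = x; revert x; decide
  rw [hA] at hlt
  have e1 := mul_res hp n i
  have e2 := mul_res hp n k
  rw [dig_eq_cell_add hp] at e1 e2
  have l1 := res_lt hp n (i + 1)
  have l2 := res_lt hp n (k + 1)
  have hmul := Nat.mul_lt_mul_of_pos_left hlt (show 0 < p by omega)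
  rw [e1, e2, hc] at hmul
  have d1 := isDrop_four_iff hA i
  have d2 := isDrop_four_iff hA k
  rw [hA (i + 1) (k + 1)]
  rw [mul_add, mul_add] at hmul
  simp only [← d1, ← d2] at hmul
  cases h1 : isDrop A 4 i <;> cases h2 : isDrop A 4 k <;> simp [h1, h2] at hmul ⊢ <;> omega

/-- The set of ranks at which `A` descends, for the order starting just after `m`. -/
noncomputable def dropRanks (A : Fin 5 → Fin 5) (m : Fin 5) : Finset (Fin 5) :=
  Finset.univ.filter fun x => isDropRank A m x

lemma prod_dropRanks {R : Type*} [CommMonoid R] {A : Fin 5 → Fin 5} (hA : A.Bijective)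
    (m : Fin 5) (f : Fin 5 → R) :
    ∏ x ∈ dropRanks A m, f x = ∏ i, if isDrop A m i then f (A i) else 1 := by
  rw [dropRanks, Finset.prod_filter, ← hA.prod_comp]
  refine Finset.prod_congr rfl fun i _ => ?_
  have : isDropRank A m (A i) ↔ isDrop A m i = true :=
    ⟨fun ⟨k, hk, h⟩ => hA.1 hk ▸ h, fun h => ⟨i, rfl, h⟩⟩
  simp only [this]

lemma card_dropRanks {A : Fin 5 → Fin 5} (hA : A.Bijective) (m : Fin 5) :
    (dropRanks A m).card = ∑ i, if isDrop A m i then 1 else 0 := by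
  have := prod_dropRanks hA m (fun _ => Multiplicative.ofAdd 1)
  have h2 := congrArg Multiplicative.toAdd this
  rw [toAdd_prod, toAdd_prod] at h2
  simp only [toAdd_ofAdd, Finset.sum_const, smul_eq_mul, mul_one] at h2
  rw [h2]
  refine Finset.sum_congr rfl fun i _ => ?_
  split_ifs <;> rfl

lemma mem_dropRanks_self {A : Fin 5 → Fin 5} (hA : A.Bijective) (m : Fin 5) :
    m ∈ dropRanks A m := by
  obtain ⟨i, rfl⟩ := hA.2 m
  simp only [dropRanks, Finset.mem_filter, Finset.mem_univ, true_and]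
  refine ⟨i, rfl, decide_eq_true (cutKey_lt_self _ _ (hA.1.ne ?_))⟩
  clear * -; revert i; decide

lemma prod_factorial_dig {p n r : ℕ} (hp : 2 ≤ p) (hr : r ≤ p - 1) {A : Fin 5 → Fin 5}
    (hAb : A.Bijective) (hA : ∀ i k, A i < A k ↔ res p n i < res p n k) {C : Fin 5 → ℕ}
    (hC : ∀ i, cell p n i = C (A i)) {m : Fin 5} (hm : ∀ i, cell p n i < r ↔ A i ≤ m) :
    ∏ i, (dig p (n + (p - 1 - r) * repunit p) i).factorial =
      (∏ j, (cutShift p r (C j)).factorial) * ∏ x ∈ dropRanks A m, (cutShift p r (C x) + 1) := by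
  rw [prod_dropRanks hAb, ← hAb.prod_comp fun j => (cutShift p r (C j)).factorial, ← Finset.prod_mul_distrib]
  refine Finset.prod_congr rfl fun i _ => ?_
  rw [dig_eq_cell_add hp, cell_shift hp n hr, hC]
  simp only [lt_iff_isDrop_shift hp hr hA hm]
  split_ifs
  · rw [Nat.factorial_succ, mul_comm]
  · simp

lemma DigitData.cutCompatible {p a b : ℕ} (hp : p.Prime) (h : DigitData p a b)
    {A B : Fin 5 → Fin 5} (hAb : A.Bijective) (hBb : B.Bijective)
    (hA : ∀ i k, A i < A k ↔ res p a i < res p a k)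
    (hB : ∀ i k, B i < B k ↔ res p b i < res p b k) {C : Fin 5 → ℕ} (hC : Monotone C)
    (hlt : ∀ j, C j < p - 1) (hCA : ∀ i, cell p a i = C (A i)) (hCB : ∀ i, cell p b i = C (B i))
    {t : Fin 5 → Bool} (ht : ∀ j, j ≠ 4 → (t j = true ↔ C j = C (j + 1)))
    (hd : numDrops p a ≤ 2) (m : Fin 5) : CutCompatible A B t m := by
  intro htm x y hxA hxB hyB hyA
  have hr : C m + 1 ≤ p - 1 := hlt m
  have hcut : ∀ j, C j < C m + 1 ↔ j ≤ m := by
    intro j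
    refine ⟨fun hj => ?_, fun hj => Nat.lt_succ_of_le (hC hj)⟩
    by_contra! hmj
    have h4 : m ≠ 4 := by rintro rfl; omega
    have h3 : m ≤ m + 1 ∧ m + 1 ≤ j := by
      revert hmj h4; clear * -; revert m j; decide
    have h5 : C m ≠ C (m + 1) := fun h5 => by simp [(ht m h4).2 h5] at htm
    have := hC h3.1
    have := hC h3.2
    omega
  have hmA : ∀ i, cell p a i < C m + 1 ↔ A i ≤ m := fun i => by rw [hCA, hcut]
  have hmB : ∀ i, cell p b i < C m + 1 ↔ B i ≤ m := fun i => by rw [hCB, hcut]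
  have : Fact p.Prime := ⟨hp⟩
  have hprod := (h 1 (p - 1 - (C m + 1)) (Nat.coprime_one_left _)).2
  rw [one_mul, one_mul, prod_factorial_dig hp.two_le hr hAb hA hCA hmA,
    prod_factorial_dig hp.two_le hr hBb hB hCB hmB, Nat.cast_mul, Nat.cast_mul] at hprod
  have hne : ∀ k : ℕ, k < p → 0 < k → ((k : ℕ) : ZMod p) ≠ 0 := fun k h1 h2 h3 => by
    rw [ZMod.natCast_eq_zero_iff] at h3
    exact absurd (Nat.le_of_dvd h2 h3) (by omega)
  have hs : ∀ j, cutShift p (C m + 1) (C j) < p - 1 := fun j => cutShift_lt (hlt j)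
  have hfac : ((∏ j, (cutShift p (C m + 1) (C j)).factorial : ℕ) : ZMod p) ≠ 0 := by
    rw [Nat.cast_prod, Finset.prod_ne_zero_iff]
    intro j _ h0
    rw [ZMod.natCast_eq_zero_iff, hp.dvd_factorial] at h0
    have := hs j
    omega
  have hprod := mul_left_cancel₀ hfac hprod
  have hcard : ∀ {n : ℕ} {A : Fin 5 → Fin 5}, A.Bijective →
      (∀ i k, A i < A k ↔ res p n i < res p n k) → (∀ i, cell p n i < C m + 1 ↔ A i ≤ m) →
      (dropRanks A m).card = numDrops p n := by
    intro n A hAb hA hmA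
    rw [card_dropRanks hAb, ← numDrops_add_mul_repunit hp.two_le n (p - 1 - (C m + 1)), numDrops,
      Finset.card_filter]
    simp only [lt_iff_isDrop_shift hp.two_le hr hA hmA]
  have cA := hcard hAb hA hmA
  have cB := hcard hBb hB hmB
  rw [← h.numDrops_eq hp.two_le hAb hBb hCA hCB] at cB
  have mA := mem_dropRanks_self hAb m
  have mB := mem_dropRanks_self hBb m
  have xA : x ∈ dropRanks A m := by simpa [dropRanks] using hxA
  have yB : y ∈ dropRanks B m := by simpa [dropRanks] using hyB
  have hmx : m ≠ x := by rintro rfl; exact hxB (by simpa [dropRanks] using mB)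
  have hmy : m ≠ y := by rintro rfl; exact hyA (by simpa [dropRanks] using mA)
  have eA : {m, x} = dropRanks A m := Finset.eq_of_subset_of_card_le
    (by intro z; simp only [Finset.mem_insert, Finset.mem_singleton]; rintro (rfl | rfl) <;> assumption)
    (by rw [Finset.card_pair hmx, cA]; exact hd)
  have eB : {m, y} = dropRanks B m := Finset.eq_of_subset_of_card_le
    (by intro z; simp only [Finset.mem_insert, Finset.mem_singleton]; rintro (rfl | rfl) <;> assumption)
    (by rw [Finset.card_pair hmy, cB]; exact hd)
  rw [← eA, ← eB, Finset.prod_pair hmx, Finset.prod_pair hmy, Nat.cast_mul, Nat.cast_mul] at hprod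
  have hm0 := hs m
  have hx0 := hs x
  have hy0 := hs y
  have hxy := mul_left_cancel₀ (hne _ (by omega) (Nat.succ_pos _)) hprod
  have hxy := (ZMod.natCast_eq_natCast_iff _ _ _).1 hxy
  have hxy := Nat.ModEq.eq_of_lt_of_lt hxy (by omega) (by omega)
  rw [classRep_eq_iff hC ht]
  exact cutShift_inj hr (hlt x) (hlt y) (by omega)

/-- The digit with symbol `s`, where `C` gives the value of each class. -/
def symValue (C : Fin 5 → ℕ) (s : Fin 5 × Bool) : ℕ := C s.1 + if s.2 then 1 else 0

lemma dig_eq_symValue {p n : ℕ} (hp : 2 ≤ p) {A : Fin 5 → Fin 5}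
    (hA : ∀ i k, A i < A k ↔ res p n i < res p n k) {C : Fin 5 → ℕ}
    (hC : ∀ i, cell p n i = C (A i)) {t : Fin 5 → Bool}
    (ht : ∀ j, j ≠ 4 → t j = true → C j = C (j + 1)) (i : Fin 5) :
    dig p n i = symValue C (symDigit A t i) := by
  rw [dig_eq_cell_add hp, hC, symValue, symDigit, classRep_spec ht]
  simp only [isDrop_four_iff hA]

lemma modEq_sum_dig {p : ℕ} (hp : 2 ≤ p) (n : ℕ) :
    n ≡ dig p n 0 * p ^ 4 + dig p n 1 * p ^ 3 + dig p n 2 * p ^ 2 + dig p n 3 * p + dig p n 4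
      [MOD modulus p] := by
  have h1 := (res_modEq p n 0).symm
  rw [res_eq_sum_dig hp] at h1
  simpa using h1

lemma modEq_of_dig_eq {p a b : ℕ} (hp : 2 ≤ p) (h : ∀ i, dig p a i = dig p b i) :
    a ≡ b [MOD modulus p] := by
  refine (modEq_sum_dig hp a).trans ?_
  simp only [h]
  exact (modEq_sum_dig hp b).symm

lemma DigitData.sum_mul_eq {p a b τ : ℕ} (h : DigitData p a b) (hτ : Nat.Coprime τ (modulus p)) :
    ∑ i, dig p (τ * a) i = ∑ i, dig p (τ * b) i := by
  simpa using (h τ 0 hτ).1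

lemma DigitData.symm {p a b : ℕ} (h : DigitData p a b) : DigitData p b a :=
  fun τ k hτ => ⟨(h τ k hτ).1.symm, (h τ k hτ).2.symm⟩

lemma DigitData.add {p a b : ℕ} (h : DigitData p a b) (j : ℕ) :
    DigitData p (a + j * repunit p) (b + j * repunit p) := by
  intro τ k hτ
  simpa only [add_mul, add_assoc] using h τ (j + k) hτ

lemma DigitData.mul {p a b : ℕ} (hp : 2 ≤ p) (h : DigitData p a b) (i j : Fin 5) :
    DigitData p (p ^ (i : ℕ) * a) (p ^ (j : ℕ) * b) := by
  have key : ∀ (i : Fin 5) (τ n k : ℕ), ∀ l, dig p (τ * (p ^ (i : ℕ) * n + k * repunit p)) l =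
      dig p (τ * (n + k * repunit p)) (l + i) := by
    intro i τ n k l
    rw [dig_add hp, dig_congr]
    have := (((mul_repunit_modEq hp i).symm.mul_left k).add_left (p ^ (i : ℕ) * n)).mul_left τ
    convert this using 1
    ring
  intro τ k hτ
  simp only [key]
  have hs : ∀ (i : Fin 5) (n : ℕ), ∑ l, dig p n (l + i) = ∑ l, dig p n l := fun i n =>
    Equiv.sum_comp (Equiv.addRight i) (dig p n)
  have hq : ∀ (i : Fin 5) (n : ℕ), ∏ l, (dig p n (l + i)).factorial =
      ∏ l, (dig p n l).factorial := fun i n =>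
    Equiv.prod_comp (Equiv.addRight i) fun l => (dig p n l).factorial
  rw [hs, hs, hq, hq]
  exact h τ k hτ

lemma sub_one_mul_sub_one_modEq {N : ℕ} (hN : 1 ≤ N) : (N - 1) * (N - 1) ≡ 1 [MOD N] := by
  obtain ⟨M, rfl⟩ : ∃ M, N = M + 1 := ⟨N - 1, by omega⟩
  rw [Nat.add_sub_cancel]
  rcases Nat.eq_zero_or_pos M with rfl | h
  · exact Nat.modEq_one
  · obtain ⟨m, rfl⟩ : ∃ m, M = m + 1 := ⟨M - 1, by omega⟩
    have : (m + 1) * (m + 1) = 1 + m * (m + 1 + 1) := by ring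
    rw [this, Nat.ModEq, Nat.add_mul_mod_self_right]

lemma DigitData.neg {p a b : ℕ} (hp : 2 ≤ p) (h : DigitData p a b) :
    DigitData p ((modulus p - 1) * a) ((modulus p - 1) * b) := by
  intro τ k hτ
  have hN := modulus_pos hp
  have hcop : Nat.Coprime (modulus p - 1) (modulus p) := by
    have := Nat.coprime_self_add_right (m := modulus p - 1) (n := 1)
    rw [Nat.sub_add_cancel hN] at this
    simp [this]
  have key : ∀ n, dig p (τ * ((modulus p - 1) * n + k * repunit p)) =
      dig p (τ * (modulus p - 1) * (n + (modulus p - 1) * k * repunit p)) := by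
    intro n
    apply dig_congr
    have h1 := ((sub_one_mul_sub_one_modEq hN).symm.mul_right (k * repunit p)).add_left
      ((modulus p - 1) * n)
    have := h1.mul_left τ
    convert this using 1
    · ring
    · ring
  simp only [key]
  exact h _ _ (Nat.Coprime.mul_left hτ hcop)

lemma modEq_of_isExceptional {p a b : ℕ} (hp : 2 ≤ p) (h : DigitData p a b) {C : Fin 5 → ℕ}
    (hC : Monotone C) (hC0 : C 0 = 0) {f g : Fin 5 → Fin 5 × Bool}
    (ha : ∀ i, dig p a i = symValue C (f i)) (hb : ∀ i, dig p b i = symValue C (g i))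
    (hfg : IsExceptional f g) : a ≡ b [MOD modulus p] := by
  have ea := modEq_sum_dig hp a
  have eb := modEq_sum_dig hp b
  have la := dig_lt hp a
  have z0 : symValue C (0, false) = 0 := by simp [symValue, hC0]
  have z1 : symValue C (0, true) = 1 := by simp [symValue, hC0]
  obtain ⟨t, ht, hct⟩ := exists_coprime_multiplier_two hp
  obtain ⟨u, hu, hcu⟩ := exists_coprime_multiplier_four hp
  rcases hfg with ⟨a0, a1, a2, a3, a4, b0, b1, b2, b3, b4⟩ |
    ⟨b0, a0, a4, ha4, hle, a1, a2, a3, b1, b2, b3⟩ | ⟨b0, a0, a1, a2, a3, a4, b1, b2, b3, b4⟩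
  · have p2 : 1 ≤ symValue C (f 2) := by simp [symValue, a2]
    have p4 : 1 ≤ symValue C (f 4) := by simp [symValue, a4]
    have l2 := ha 2 ▸ la 2
    have l4 := ha 4 ▸ la 4
    simp only [ha, hb, a0, a1, a3, b0, b1, b2, b3, b4, z0, zero_mul, zero_add, add_zero] at ea eb
    rcases lt_trichotomy (symValue C (f 2)) (symValue C (f 4)) with hlt | heq | hlt
    · exact absurd (h.sum_mul_eq hcu) (sum_dig_swap_ne hp p2 hlt l4 hu ea eb)
    · rw [heq] at ea eb
      exact ea.trans eb.symm
    · exact absurd (h.sum_mul_eq hcu).symm (sum_dig_swap_ne hp p4 hlt l2 hu eb ea)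
  · have hlt : symValue C (f 4) < symValue C (f 0) := by
      simpa [symValue, a0, ha4] using Nat.lt_succ_of_le (hC hle)
    have l0 := ha 0 ▸ la 0
    simp only [ha, hb, ← a4, a1, a2, a3, b0, b1, b2, b3, z0, z1, zero_mul, add_zero, one_mul] at ea eb
    exact absurd (h.sum_mul_eq hct) (sum_dig_shift_one_ne hp hlt l0 ht ea eb)
  · have p0 : 1 ≤ symValue C (f 0) := by simp [symValue, a0]
    have l0 := ha 0 ▸ la 0
    simp only [ha, hb, a1, a2, a3, a4, b0, b1, b2, b3, b4, z0, z1, zero_mul, add_zero,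
      one_mul] at ea eb
    exact absurd (h.sum_mul_eq hct) (sum_dig_shift_two_ne hp p0 l0 ht ea eb)

lemma pow_mul_cancel {p a b : ℕ} (hp : 2 ≤ p) (i : Fin 5) (j : ℕ)
    (h : p ^ (i : ℕ) * a ≡ p ^ j * b [MOD modulus p]) :
    a ≡ p ^ (5 - (i : ℕ) + j) * b [MOD modulus p] := by
  have h1 := h.mul_left (p ^ (5 - (i : ℕ)))
  rw [← mul_assoc, ← mul_assoc, ← pow_add, ← pow_add, Nat.sub_add_cancel i.2.le] at h1
  have h2 := (pow_five_modEq hp).mul_right a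
  rw [one_mul] at h2
  exact h2.symm.trans h1

lemma rank_zero {p n : ℕ} {A : Fin 5 → Fin 5} (hbij : A.Bijective)
    (hA : ∀ i k, A i < A k ↔ res p n i < res p n k) (h : ∀ k, res p n 0 ≤ res p n k) :
    A 0 = 0 := by
  obtain ⟨k, hk⟩ := hbij.2 0
  by_contra h0
  have : A k < A 0 := by rw [hk]; exact Fin.pos_of_ne_zero h0
  rw [hA] at this
  exact absurd (h k) (by omega)

lemma DigitData.exists_modEq_of_normalized {p a b : ℕ} (hp : p.Prime) (h : DigitData p a b)
    (ha : (res p a).Injective) (hb : (res p b).Injective) (hd : numDrops p a ≤ 2)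
    (hmax : ∀ x, (Finset.univ.filter fun i => cell p a i = cell p a x).card ≤
      (Finset.univ.filter fun i => cell p a i = 0).card)
    (ha0 : ∀ k, res p a 0 ≤ res p a k) (hb0 : ∀ k, res p b 0 ≤ res p b k) :
    ∃ j, a ≡ p ^ j * b [MOD modulus p] := by
  obtain ⟨A, hAb, hA⟩ := exists_rank ha
  obtain ⟨B, hBb, hB⟩ := exists_rank hb
  obtain ⟨C, hC, hlt, hCA, hCB⟩ := h.exists_cells hp.two_le hAb hBb hA hB
  have hC0 : C 0 = 0 := by
    have h1 : 0 < (Finset.univ.filter fun i => cell p a i = cell p a 0).card :=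
      Finset.card_pos.2 ⟨0, by simp⟩
    obtain ⟨i, hi⟩ := Finset.card_pos.1 (h1.trans_le (hmax 0))
    simp only [Finset.mem_filter, Finset.mem_univ, true_and, hCA] at hi
    exact Nat.le_zero.1 (hi ▸ hC (Fin.zero_le _))
  let t : Fin 5 → Bool := fun j => decide (j ≠ 4 ∧ C j = C (j + 1))
  have ht1 : ∀ j, t j = true → j ≠ 4 ∧ C j = C (j + 1) := fun j hj => of_decide_eq_true hj
  have ht2 : ∀ j, j ≠ 4 → (t j = true ↔ C j = C (j + 1)) := fun j hj =>
    ⟨fun h => (ht1 j h).2, fun h => decide_eq_true ⟨hj, h⟩⟩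
  have ht3 : ∀ j, j ≠ 4 → t j = true → C j = C (j + 1) := fun j hj => (ht2 j hj).1
  have hsize : ∀ x, classSize t x = (Finset.univ.filter fun i => cell p a i = C x).card := by
    intro x
    simp only [hCA]
    rw [card_filter_comp hAb fun j => C j = C x, Finset.card_filter]
    simp only [classSize, classRep_eq_iff hC ht2]
  have hout := outcome hAb.1 hBb.1 (rank_zero hAb hA ha0) (rank_zero hBb hB hb0)
    (t := t) (by simp [t]) (dropCount_eq hA ▸ hd)
    (by rw [dropCount_eq hA, dropCount_eq hB, h.numDrops_eq hp.two_le hAb hBb hCA hCB])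
    (tieCompatible hp.two_le hA hCA ht1) (tieCompatible hp.two_le hB hCB ht1)
    (fun x => by
      obtain ⟨i, rfl⟩ := hAb.2 x
      rw [hsize, hsize, ← hCA, hC0]
      exact hmax i)
    (h.cutCompatible hp hAb hBb hA hB hC hlt hCA hCB ht2 hd)
  have da := dig_eq_symValue hp.two_le hA hCA ht3
  have db := dig_eq_symValue hp.two_le hB hCB ht3
  rcases hout with ⟨j, hj⟩ | ⟨j, k, hjk⟩
  · refine ⟨j, modEq_of_dig_eq hp.two_le fun i => ?_⟩
    rw [← dig_add hp.two_le, da, db, hj]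
  · have da' : ∀ i, dig p (p ^ (j : ℕ) * a) i = symValue C (symDigit A t (i + j)) := fun i => by
      rw [← dig_add hp.two_le, da]
    have db' : ∀ i, dig p (p ^ (k : ℕ) * b) i = symValue C (symDigit B t (i + k)) := fun i => by
      rw [← dig_add hp.two_le, db]
    have hjk' : p ^ (j : ℕ) * a ≡ p ^ (k : ℕ) * b [MOD modulus p] := by
      rcases hjk with hjk | hjk
      · exact modEq_of_isExceptional hp.two_le (h.mul hp.two_le j k) hC hC0 da' db' hjk
      · exact (modEq_of_isExceptional hp.two_le (h.mul hp.two_le j k).symm hC hC0 db' da' hjk).symm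
    exact ⟨_, pow_mul_cancel hp.two_le j k hjk'⟩

lemma numDrops_mul {p : ℕ} (hp : 2 ≤ p) (n : ℕ) (j : Fin 5) :
    numDrops p (p ^ (j : ℕ) * n) = numDrops p n := by
  simp only [numDrops, ← res_add hp, Finset.card_filter, add_right_comm _ (1 : Fin 5) j]
  exact Equiv.sum_comp (Equiv.addRight j) fun i => if res p n (i + 1) < res p n i then 1 else 0

lemma res_injective_add {p n : ℕ} (hp : 2 ≤ p) (h : (res p n).Injective) (k : ℕ) :
    (res p (n + k * repunit p)).Injective := by
  intro i j hij
  apply h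
  have h1 : p ^ (i : ℕ) * (n + k * repunit p) ≡ p ^ (j : ℕ) * (n + k * repunit p)
    [MOD modulus p] := hij
  have h2 := ((mul_repunit_modEq hp i).trans (mul_repunit_modEq hp j).symm).mul_left k
  rw [mul_add, mul_add, mul_left_comm, mul_left_comm (p ^ (j : ℕ))] at h1
  exact Nat.ModEq.add_right_cancel h2 h1

lemma res_injective_mul {p n : ℕ} (hp : 2 ≤ p) (h : (res p n).Injective) (j : Fin 5) :
    (res p (p ^ (j : ℕ) * n)).Injective := by
  intro i k hik
  rw [← res_add hp, ← res_add hp] at hik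
  exact add_right_cancel (h hik)

lemma DigitData.exists_modEq_of_numDrops_le {p a b : ℕ} (hp : p.Prime) (h : DigitData p a b)
    (ha : (res p a).Injective) (hb : (res p b).Injective) (hd : numDrops p a ≤ 2) :
    ∃ j, a ≡ p ^ j * b [MOD modulus p] := by
  have hp2 := hp.two_le
  obtain ⟨x₀, hx₀⟩ := Finite.exists_max fun x =>
    (Finset.univ.filter fun i => cell p a i = cell p a x).card
  have hr : cell p a x₀ ≤ p - 1 := (cell_lt hp2 a x₀).le
  set k := p - 1 - cell p a x₀ with hk
  obtain ⟨i, hi⟩ := Finite.exists_min (res p (a + k * repunit p))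
  obtain ⟨j, hj⟩ := Finite.exists_min (res p (b + k * repunit p))
  have hcell : ∀ x y, cell p (a + k * repunit p) x = cell p (a + k * repunit p) y ↔
      cell p a x = cell p a y := by
    intro x y
    rw [hk, cell_shift hp2 _ hr, cell_shift hp2 _ hr]
    exact ⟨cutShift_inj hr (cell_lt hp2 _ _) (cell_lt hp2 _ _), fun h => by rw [h]⟩
  have hcell0 : cell p (a + k * repunit p) x₀ = 0 := by
    rw [hk, cell_shift hp2 _ hr, cutShift]; simp
  have hrot : ∀ x, cell p (p ^ (i : ℕ) * (a + k * repunit p)) x =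
      cell p (a + k * repunit p) (x + i) := fun x => by rw [cell, cell, res_add hp2]
  obtain ⟨l, hl⟩ := ((h.add k).mul hp2 i j).exists_modEq_of_normalized hp
    (res_injective_mul hp2 (res_injective_add hp2 ha k) i)
    (res_injective_mul hp2 (res_injective_add hp2 hb k) j)
    (by rwa [numDrops_mul hp2, numDrops_add_mul_repunit hp2])
    (fun x => by
      simp only [hrot]
      rw [← hcell0]
      simp only [hcell]
      rw [card_filter_comp (A := fun y => y + i) (Equiv.addRight i).bijective fun y => cell p a y = cell p a (x + i),
        card_filter_comp (A := fun y => y + i) (Equiv.addRight i).bijective fun y => cell p a y = cell p a x₀]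
      exact hx₀ _)
    (fun x => by rw [← res_add hp2, ← res_add hp2, zero_add]; exact hi _)
    (fun x => by rw [← res_add hp2, ← res_add hp2, zero_add]; exact hj _)
  rw [← mul_assoc, ← pow_add] at hl
  have h1 := pow_mul_cancel hp2 i _ hl
  refine ⟨_, Nat.ModEq.add_right_cancel ?_ (h1.trans (by rw [mul_add]))⟩
  have := (mul_repunit_modEq hp2 (5 - (i : ℕ) + (l + j))).symm.mul_left k
  rwa [mul_left_comm] at this

lemma res_neg {p n : ℕ} (hp : 2 ≤ p) (i : Fin 5) (h : res p n i ≠ 0) :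
    res p ((modulus p - 1) * n) i = modulus p - res p n i := by
  have hlt := res_lt hp n i
  have hlt' := res_lt hp ((modulus p - 1) * n) i
  have h1 : res p ((modulus p - 1) * n) i + res p n i ≡ 0 [MOD modulus p] := by
    refine ((res_modEq p _ i).add (res_modEq p n i)).trans ?_
    obtain ⟨M, hM⟩ : ∃ M, modulus p = M + 1 := ⟨modulus p - 1, by omega⟩
    rw [hM, Nat.add_sub_cancel, show p ^ (i : ℕ) * (M * n) + p ^ (i : ℕ) * n =
      (M + 1) * (p ^ (i : ℕ) * n) by ring]
    simp [Nat.ModEq]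
  obtain ⟨c, hc⟩ := (Nat.modEq_zero_iff_dvd).1 h1
  have hc1 : c = 1 := by
    rcases c with _ | _ | c
    · omega
    · rfl
    · rw [mul_add, mul_add] at hc; omega
  subst hc1
  omega

lemma numDrops_neg {p n : ℕ} (hp : 2 ≤ p) (h : (res p n).Injective) :
    numDrops p ((modulus p - 1) * n) + numDrops p n = 5 := by
  have h0 : ∀ i, res p n i ≠ 0 := by
    intro i hi
    have h1 := mul_res hp n i
    rw [hi, mul_zero] at h1
    have : i = i + 1 := h (by omega)
    revert this; clear * -; revert i; decide
  rw [numDrops, numDrops, Finset.card_filter, Finset.card_filter, ← Finset.sum_add_distrib]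
  rw [Finset.sum_congr rfl (g := fun _ => 1)]
  · simp
  · intro i _
    rw [res_neg hp _ (h0 _), res_neg hp _ (h0 _)]
    have h1 := res_lt hp n i
    have h2 := res_lt hp n (i + 1)
    have h3 : res p n i ≠ res p n (i + 1) := h.ne (by clear * -; revert i; decide)
    split_ifs <;> omega

lemma res_injective_neg {p n : ℕ} (hp : 2 ≤ p) (h : (res p n).Injective) :
    (res p ((modulus p - 1) * n)).Injective := by
  have key : ∀ i, res p ((modulus p - 1) * ((modulus p - 1) * n)) i = res p n i := by
    intro i
    apply congrFun
    apply res_congr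
    simpa [mul_assoc] using (sub_one_mul_sub_one_modEq (modulus_pos hp)).mul_right n
  intro i j hij
  apply h
  rw [← key, ← key]
  have h1 : p ^ (i : ℕ) * ((modulus p - 1) * n) ≡ p ^ (j : ℕ) * ((modulus p - 1) * n)
    [MOD modulus p] := hij
  have h2 := h1.mul_left (modulus p - 1)
  rw [mul_left_comm, mul_left_comm _ (p ^ (j : ℕ))] at h2
  exact h2

theorem DigitData.exists_modEq {p a b : ℕ} (hp : p.Prime) (h : DigitData p a b)
    (ha : (res p a).Injective) (hb : (res p b).Injective) :
    ∃ j, a ≡ p ^ j * b [MOD modulus p] := by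
  by_cases hd : numDrops p a ≤ 2
  · exact h.exists_modEq_of_numDrops_le hp ha hb hd
  · have hp2 := hp.two_le
    have hs := numDrops_neg hp2 ha
    obtain ⟨j, hj⟩ := (h.neg hp2).exists_modEq_of_numDrops_le hp (res_injective_neg hp2 ha)
      (res_injective_neg hp2 hb) (by omega)
    refine ⟨j, ?_⟩
    have h1 : ∀ n, (modulus p - 1) * ((modulus p - 1) * n) ≡ n [MOD modulus p] := fun n => by
      simpa [mul_assoc] using (sub_one_mul_sub_one_modEq (modulus_pos hp2)).mul_right n
    have h2 := (h1 a).symm.trans (hj.mul_left (modulus p - 1))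
    rw [mul_left_comm _ (p ^ j)] at h2
    exact h2.trans ((h1 b).mul_left _)

theorem cast_modulus_eq_neg_one {E : Type*} [Field E] {p : ℕ} (hp : p.Prime) [CharP E p] :
    ((modulus p : ℕ) : E) = -1 := by
  have h := congrArg (Nat.cast : ℕ → E) (modulus_add_one hp.two_le)
  push_cast [CharP.cast_eq_zero] at h
  rw [zero_pow (by norm_num)] at h
  exact eq_neg_of_add_eq_zero_left h

set_option linter.unusedSectionVars false

section GaussSumCongruence

variable {E O k : Type*} [Field E] [Fintype E] [CommRing O] [Field k]

theorem card_sub_one_eq_modulus {p : ℕ} (hp : p.Prime) (hE : Fintype.card E = p ^ 5) :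
    Fintype.card E - 1 = modulus p := by
  have := modulus_add_one hp.two_le
  omega

theorem sum_pow_eq_ite {p : ℕ} (hp : p.Prime) (hE : Fintype.card E = p ^ 5) {i : ℕ}
    (hi : i ≠ 0) : ∑ x : E, x ^ i = if modulus p ∣ i then -1 else 0 := by
  have h0 : ∑ x : E, x ^ i = ∑ x ∈ ({0}ᶜ : Finset E), x ^ i := by
    refine (Finset.sum_subset (Finset.subset_univ _) fun x _ hx => ?_).symm
    have : x = 0 := by simpa using hx
    simp [this, hi]
  rw [← card_sub_one_eq_modulus hp hE, ← FiniteField.sum_pow_units, h0]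
  refine (Finset.sum_bij (fun (x : Eˣ) _ => (x : E)) ?_ ?_ ?_ ?_).symm
  · simp
  · intro a _ b _ h
    exact Units.ext h
  · intro b hb
    exact ⟨Units.mk0 b (by simpa using hb), by simp, rfl⟩
  · simp

theorem inv_pow_eq_pow {p : ℕ} (hp : p.Prime) (hE : Fintype.card E = p ^ 5) (x : E) {m : ℕ}
    (hm : m ≠ 0) (hmN : m < modulus p) : (x⁻¹) ^ m = x ^ (modulus p - m) := by
  by_cases hx : x = 0
  · rw [hx, inv_zero, zero_pow hm, zero_pow (by omega)]
  · have h := FiniteField.pow_card_sub_one_eq_one x hx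
    rw [card_sub_one_eq_modulus hp hE] at h
    rw [inv_pow]
    refine inv_eq_of_mul_eq_one_right ?_
    rw [← pow_add, show m + (modulus p - m) = modulus p by omega, h]

theorem two_lt_modulus {p : ℕ} (hp : 2 ≤ p) : 2 < modulus p := by
  have h := modulus_add_one hp
  have := Nat.pow_le_pow_left hp 5
  omega

theorem sum_inv_mul_one_sub_inv_pow {p : ℕ} (hp : p.Prime) [CharP E p]
    (hE : Fintype.card E = p ^ 5) {n : ℕ} (h2 : 2 ≤ n) (hn : n < modulus p) :
    ∑ x : E, x⁻¹ * ((1 - x)⁻¹) ^ (n - 1) = -(n : E) := by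
  have hN := two_lt_modulus hp.two_le
  set N := modulus p with hNdef
  calc ∑ x : E, x⁻¹ * ((1 - x)⁻¹) ^ (n - 1)
      = ∑ x : E, ∑ j ∈ Finset.range (N - (n - 1) + 1),
          ((-1) ^ j * ((N - (n - 1)).choose j : E)) * x ^ (N - 1 + j) := by
        refine Finset.sum_congr rfl fun x _ => ?_
        have h1 := inv_pow_eq_pow hp hE x one_ne_zero (by omega)
        rw [pow_one] at h1
        rw [h1, inv_pow_eq_pow hp hE _ (by omega) (by omega), ← hNdef,
          sub_eq_neg_add, add_pow, Finset.mul_sum]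
        refine Finset.sum_congr rfl fun j _ => ?_
        rw [neg_pow x j, one_pow, pow_add]
        ring
    _ = ∑ j ∈ Finset.range (N - (n - 1) + 1),
          ((-1) ^ j * ((N - (n - 1)).choose j : E)) * (if N ∣ N - 1 + j then -1 else 0) := by
        rw [Finset.sum_comm]
        refine Finset.sum_congr rfl fun j _ => ?_
        rw [← Finset.mul_sum, sum_pow_eq_ite hp hE (by omega)]
    _ = ((-1) ^ 1 * ((N - (n - 1)).choose 1 : E)) * (if N ∣ N - 1 + 1 then -1 else 0) := by
        refine Finset.sum_eq_single_of_mem 1 (by simp; omega) fun j hj hj1 => ?_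
        rw [if_neg, mul_zero]
        rintro ⟨c, hc⟩
        rw [Finset.mem_range] at hj
        have : c = 1 := by
          have h1 : N * 0 < N * c := by omega
          have h2 : N * c < N * 2 := by omega
          have := Nat.lt_of_mul_lt_mul_left h1
          have := Nat.lt_of_mul_lt_mul_left h2
          omega
        subst this
        omega
    _ = -(n : E) := by
        rw [if_pos (by rw [Nat.sub_add_cancel (by omega)]), Nat.choose_one_right,
          Nat.cast_sub (by omega), Nat.cast_sub (by omega), hNdef, cast_modulus_eq_neg_one hp]
        push_cast
        ring

theorem sum_inv_mul_trace {p : ℕ} [Fact p.Prime] [Algebra (ZMod p) E]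
    (hE : Fintype.card E = p ^ 5) :
    ∑ x : E, x⁻¹ * algebraMap (ZMod p) E (Algebra.trace (ZMod p) E x) = -1 := by
  have hp : p.Prime := Fact.out
  have hN := two_lt_modulus hp.two_le
  have hq := modulus_add_one hp.two_le
  have hr : Module.finrank (ZMod p) E = 5 := by
    have h := Module.card_eq_pow_finrank (K := ZMod p) (V := E)
    rw [hE, ZMod.card] at h
    exact (Nat.pow_right_injective hp.two_le h).symm
  have hpi : ∀ i : ℕ, 0 < p ^ i := fun i => pow_pos hp.pos i
  calc ∑ x : E, x⁻¹ * algebraMap (ZMod p) E (Algebra.trace (ZMod p) E x)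
      = ∑ x : E, ∑ i ∈ Finset.range 5, x ^ (modulus p - 1 + p ^ i) := by
        refine Finset.sum_congr rfl fun x _ => ?_
        have h1 := inv_pow_eq_pow hp hE x one_ne_zero (by omega)
        rw [pow_one] at h1
        rw [FiniteField.algebraMap_trace_eq_sum_pow, hr, Nat.card_zmod, h1, Finset.mul_sum]
        exact Finset.sum_congr rfl fun i _ => (pow_add _ _ _).symm
    _ = ∑ i ∈ Finset.range 5, if modulus p ∣ modulus p - 1 + p ^ i then (-1 : E) else 0 := by
        rw [Finset.sum_comm]
        exact Finset.sum_congr rfl fun i _ => sum_pow_eq_ite hp hE (by omega)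
    _ = if modulus p ∣ modulus p - 1 + p ^ 0 then (-1 : E) else 0 := by
        refine Finset.sum_eq_single_of_mem 0 (by simp) fun i hi hi0 => if_neg ?_
        rintro ⟨c, hc⟩
        rw [Finset.mem_range] at hi
        have h1 : p ^ i * p ≤ p ^ 5 := by
          rw [← pow_succ]; exact Nat.pow_le_pow_right hp.pos (by omega)
        have h2 : p ^ 1 ≤ p ^ i := Nat.pow_le_pow_right hp.pos (by omega)
        rw [pow_one] at h2
        have h3 := Nat.mul_le_mul_left (p ^ i) hp.two_le
        have h4 := hp.two_le
        have h5 : modulus p * 1 < modulus p * c := by omega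
        have h6 : modulus p * c < modulus p * 2 := by omega
        have := Nat.lt_of_mul_lt_mul_left h5
        have := Nat.lt_of_mul_lt_mul_left h6
        omega
    _ = -1 := if_pos (by rw [pow_zero, Nat.sub_add_cancel (by omega)])

theorem gaussSum_pow_mul_prime {p : ℕ} (hp : p.Prime) [CharP E p] (S : MulChar E O)
    (ψ : AddChar E O) (hψ : ∀ x, ψ (x ^ p) = ψ x) (n : ℕ) :
    gaussSum (S ^ (n * p)) ψ = gaussSum (S ^ n) ψ := by
  have : Fact p.Prime := ⟨hp⟩
  have hb : Function.Bijective (frobenius E p) :=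
    Finite.injective_iff_bijective.mp (frobenius_inj E p)
  unfold gaussSum
  rw [← hb.sum_comp fun x => (S ^ n) x * ψ x]
  refine Finset.sum_congr rfl fun x _ => ?_
  rw [frobenius_def, hψ, map_pow, pow_mul, MulChar.pow_apply' _ hp.ne_zero]

end GaussSumCongruence

section GaussSumCongruence

variable {E O k : Type*} [Field E] [Fintype E] [CommRing O] [IsDomain O] [Field k]

theorem map_mulChar_pow_apply {ρ : O →+* k} {ι : E →+* k} {S : MulChar E O}
    (hS : ∀ x, ρ (S x) = ι x⁻¹) {n : ℕ} (hn : n ≠ 0) (x : E) :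
    ρ ((S ^ n) x) = ι ((x⁻¹) ^ n) := by
  rw [MulChar.pow_apply' _ hn, map_pow, hS, map_pow]

theorem mulChar_pow_ne_one {p : ℕ} (hp : p.Prime) (hE : Fintype.card E = p ^ 5)
    {ρ : O →+* k} {ι : E →+* k} {S : MulChar E O} (hS : ∀ x, ρ (S x) = ι x⁻¹) {n : ℕ}
    (hn : n ≠ 0) (hnN : n < modulus p) : S ^ n ≠ 1 := by
  intro h
  obtain ⟨g, hg⟩ := IsCyclic.exists_generator (α := Eˣ)
  have ho : orderOf g = modulus p := by
    rw [orderOf_eq_card_of_forall_mem_zpowers hg, Nat.card_eq_fintype_card, Fintype.card_units,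
      card_sub_one_eq_modulus hp hE]
  have h1 := map_mulChar_pow_apply hS hn (g : E)
  rw [h, MulChar.one_apply_coe, map_one, eq_comm, map_eq_one_iff _ ι.injective, inv_pow,
    inv_eq_one] at h1
  have h2 : orderOf g ∣ n := orderOf_dvd_of_pow_eq_one (Units.ext (by simpa using h1))
  rw [ho] at h2
  exact absurd (Nat.le_of_dvd (by omega) h2) (by omega)

theorem gaussSum_self_eq {p : ℕ} [Fact p.Prime] [Algebra (ZMod p) E]
    (hE : Fintype.card E = p ^ 5) {ρ : O →+* k} {ι : E →+* k} {S : MulChar E O}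
    (hS : ∀ x, ρ (S x) = ι x⁻¹) {ψ : AddChar E O} {ϖ : O}
    (hψ : ∀ x, ∃ y, ψ x = 1 + ϖ * y ∧
      ρ y = ι (algebraMap (ZMod p) E (Algebra.trace (ZMod p) E x))) :
    ∃ w, gaussSum S ψ = ϖ * w ∧ ρ w = -1 := by
  have hp : p.Prime := Fact.out
  have hN := two_lt_modulus hp.two_le
  choose y hy hρ using hψ
  refine ⟨∑ x, S x * y x, ?_, ?_⟩
  · have h1 : S ≠ 1 := by
      simpa using mulChar_pow_ne_one hp hE hS one_ne_zero (by omega)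
    unfold gaussSum
    rw [Finset.mul_sum, ← sub_eq_zero, ← Finset.sum_sub_distrib,
      ← MulChar.sum_eq_zero_of_ne_one h1]
    refine Finset.sum_congr rfl fun x _ => ?_
    rw [hy]
    ring
  · rw [map_sum]
    calc ∑ x, ρ (S x * y x)
        = ι (∑ x : E, x⁻¹ * algebraMap (ZMod p) E (Algebra.trace (ZMod p) E x)) := by
          rw [map_sum]
          exact Finset.sum_congr rfl fun x _ => by rw [map_mul, hS, hρ, ← map_mul]
      _ = -1 := by rw [sum_inv_mul_trace hE, map_neg, map_one]

theorem map_jacobiSum_eq {p : ℕ} (hp : p.Prime) [CharP E p]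
    (hE : Fintype.card E = p ^ 5) {ρ : O →+* k} {ι : E →+* k} {S : MulChar E O}
    (hS : ∀ x, ρ (S x) = ι x⁻¹) {n : ℕ} (h2 : 2 ≤ n) (hn : n < modulus p) :
    ρ (jacobiSum S (S ^ (n - 1))) = -(n : k) := by
  calc ρ (jacobiSum S (S ^ (n - 1)))
      = ι (∑ x : E, x⁻¹ * ((1 - x)⁻¹) ^ (n - 1)) := by
        unfold jacobiSum
        rw [map_sum, map_sum]
        refine Finset.sum_congr rfl fun x _ => ?_
        rw [map_mul, hS, map_mulChar_pow_apply hS (by omega), ← map_mul]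
    _ = -(n : k) := by
        rw [sum_inv_mul_one_sub_inv_pow hp hE h2 hn, map_neg, map_natCast]

theorem stickelberger_congruence {p : ℕ} [Fact p.Prime] [Algebra (ZMod p) E]
    (hE : Fintype.card E = p ^ 5) {ρ : O →+* k} [IsLocalHom ρ] {ι : E →+* k} {S : MulChar E O}
    (hS : ∀ x, ρ (S x) = ι x⁻¹) {ψ : AddChar E O} {ϖ : O}
    (hψ1 : ψ ≠ 1) (hψp : ∀ x, ψ (x ^ p) = ψ x)
    (hψ : ∀ x, ∃ y, ψ x = 1 + ϖ * y ∧
      ρ y = ι (algebraMap (ZMod p) E (Algebra.trace (ZMod p) E x))) (s : ℕ) :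
    ∀ a b c d e : ℕ, a < p → b < p → c < p → d < p → e < p → a + b + c + d + e = s →
      s < 5 * (p - 1) →
      ∃ w, gaussSum (S ^ (a * p ^ 4 + b * p ^ 3 + c * p ^ 2 + d * p + e)) ψ = ϖ ^ s * w ∧
        ρ w * ((a.factorial * b.factorial * c.factorial * d.factorial * e.factorial : ℕ) : k)
          = -1 := by
  have hp : p.Prime := Fact.out
  have : CharP E p := charP_of_injective_algebraMap (algebraMap (ZMod p) E).injective p
  have : CharP k p := charP_of_injective_ringHom ι.injective p
  have hN := two_lt_modulus hp.two_le
  have hq := modulus_add_one hp.two_le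
  have hSN : S ^ (p ^ 5) = S := by
    have h := MulChar.pow_card_eq_one S
    rw [Fintype.card_units, card_sub_one_eq_modulus hp hE] at h
    rw [← hq, pow_succ, h, one_mul]
  have hrot : ∀ a b c d e : ℕ,
      gaussSum (S ^ (b * p ^ 4 + c * p ^ 3 + d * p ^ 2 + e * p + a)) ψ =
        gaussSum (S ^ (a * p ^ 4 + b * p ^ 3 + c * p ^ 2 + d * p + e)) ψ := by
    intro a b c d e
    rw [← gaussSum_pow_mul_prime hp S ψ hψp (a * p ^ 4 + b * p ^ 3 + c * p ^ 2 + d * p + e)]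
    congr 1
    rw [show (a * p ^ 4 + b * p ^ 3 + c * p ^ 2 + d * p + e) * p =
      p ^ 5 * a + (b * p ^ 4 + c * p ^ 3 + d * p ^ 2 + e * p) by ring, pow_add S (p ^ 5 * a),
      pow_mul S, hSN, ← pow_add]
    congr 1
    ring
  induction s with
  | zero =>
    intro a b c d e _ _ _ _ _ hs _
    obtain ⟨rfl, rfl, rfl, rfl, rfl⟩ : a = 0 ∧ b = 0 ∧ c = 0 ∧ d = 0 ∧ e = 0 := by omega
    exact ⟨-1, by simp [gaussSum_one_left hψ1], by simp⟩
  | succ s ih =>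
    have key : ∀ a b c d e : ℕ, a < p → b < p → c < p → d < p → e + 1 < p →
        a + b + c + d + (e + 1) = s + 1 → s + 1 < 5 * (p - 1) →
        ∃ w, gaussSum (S ^ (a * p ^ 4 + b * p ^ 3 + c * p ^ 2 + d * p + (e + 1))) ψ
            = ϖ ^ (s + 1) * w ∧
          ρ w * ((a.factorial * b.factorial * c.factorial * d.factorial * (e + 1).factorial : ℕ)
            : k) = -1 := by
      intro a b c d e ha hb hc hd he hs hs5
      obtain ⟨w₁, hw₁, hρ₁⟩ := gaussSum_self_eq hE hS hψ
      set n := a * p ^ 4 + b * p ^ 3 + c * p ^ 2 + d * p + (e + 1) with hn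
      have hnN : n < modulus p := by
        have hle : n ≤ modulus p := by
          obtain ⟨r, rfl⟩ : ∃ r, p = r + 1 := ⟨p - 1, by omega⟩
          have h1 : n ≤ r * (r + 1) ^ 4 + r * (r + 1) ^ 3 + r * (r + 1) ^ 2 + r * (r + 1) + r := by
            rw [hn]
            gcongr <;> omega
          have h2 : r * (r + 1) ^ 4 + r * (r + 1) ^ 3 + r * (r + 1) ^ 2 + r * (r + 1) + r + 1 =
            (r + 1) ^ 5 := by ring
          omega
        refine lt_of_le_of_ne hle fun hne => ?_
        obtain ⟨r, rfl⟩ : ∃ r, p = r + 1 := ⟨p - 1, by omega⟩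
        have h2 : r * (r + 1) ^ 4 + r * (r + 1) ^ 3 + r * (r + 1) ^ 2 + r * (r + 1) + r + 1 =
            (r + 1) ^ 5 := by ring
        have h3 : a * (r + 1) ^ 4 ≤ r * (r + 1) ^ 4 := by gcongr; omega
        have h4 : b * (r + 1) ^ 3 ≤ r * (r + 1) ^ 3 := by gcongr; omega
        have h5 : c * (r + 1) ^ 2 ≤ r * (r + 1) ^ 2 := by gcongr; omega
        have h6 : d * (r + 1) ≤ r * (r + 1) := by gcongr; omega
        have ha' : a = r := Nat.eq_of_mul_eq_mul_right (pow_pos hp.pos 4)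
          (show a * (r + 1) ^ 4 = r * (r + 1) ^ 4 by omega)
        have hb' : b = r := Nat.eq_of_mul_eq_mul_right (pow_pos hp.pos 3)
          (show b * (r + 1) ^ 3 = r * (r + 1) ^ 3 by omega)
        have hc' : c = r := Nat.eq_of_mul_eq_mul_right (pow_pos hp.pos 2)
          (show c * (r + 1) ^ 2 = r * (r + 1) ^ 2 by omega)
        have hd' : d = r := Nat.eq_of_mul_eq_mul_right hp.pos
          (show d * (r + 1) = r * (r + 1) by omega)
        have he' : e + 1 = r := by omega
        omega
      by_cases hn1 : n = 1
      · have hz : a = 0 ∧ b = 0 ∧ c = 0 ∧ d = 0 ∧ e = 0 := by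
          refine ⟨?_, ?_, ?_, ?_, by omega⟩ <;>
          · by_contra h0
            have := Nat.mul_pos (Nat.pos_of_ne_zero h0) (pow_pos hp.pos 4)
            have := Nat.mul_pos (Nat.pos_of_ne_zero h0) (pow_pos hp.pos 3)
            have := Nat.mul_pos (Nat.pos_of_ne_zero h0) (pow_pos hp.pos 2)
            have := Nat.mul_pos (Nat.pos_of_ne_zero h0) hp.pos
            omega
        obtain ⟨rfl, rfl, rfl, rfl, rfl⟩ := hz
        obtain rfl : s = 0 := by omega
        refine ⟨w₁, ?_, by simpa using hρ₁⟩
        rw [hn1, pow_one, zero_add, pow_one, hw₁]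
      · have hn2 : 2 ≤ n := by omega
        obtain ⟨w', hw', hρ'⟩ := ih a b c d e ha hb hc hd (by omega) (by omega) (by omega)
        have hn' : a * p ^ 4 + b * p ^ 3 + c * p ^ 2 + d * p + e = n - 1 := by omega
        rw [hn'] at hw'
        have hJ := map_jacobiSum_eq hp hE hS hn2 hnN
        have hnk : (n : k) = ((e + 1 : ℕ) : k) := by
          rw [hn]
          push_cast [CharP.cast_eq_zero k p]
          ring
        have he0 : ((e + 1 : ℕ) : k) ≠ 0 := by
          rw [Ne, CharP.cast_eq_zero_iff k p]
          exact fun h => absurd (Nat.le_of_dvd (by omega) h) (by omega)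
        rw [hnk] at hJ
        obtain ⟨u, hu⟩ : IsUnit (jacobiSum S (S ^ (n - 1))) := by
          apply isUnit_of_map_unit ρ
          rw [hJ]
          exact (neg_ne_zero.mpr he0).isUnit
        have hmul : S * S ^ (n - 1) = S ^ n := by
          rw [← pow_succ', Nat.sub_add_cancel (by omega)]
        have hjac := jacobiSum_mul_nontrivial (χ := S) (φ := S ^ (n - 1))
          (by rw [hmul]; exact mulChar_pow_ne_one hp hE hS (by omega) hnN) ψ
        rw [hmul, ← hu, hw₁, hw'] at hjac
        refine ⟨w₁ * w' * (u⁻¹ : Oˣ), ?_, ?_⟩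
        · rw [(Units.eq_mul_inv_iff_mul_eq u).mpr hjac]
          ring
        · have hρu : ρ (u⁻¹ : Oˣ) * -((e + 1 : ℕ) : k) = 1 := by
            rw [← hJ, ← hu, ← map_mul, Units.inv_mul, map_one]
          rw [map_mul, map_mul, hρ₁, Nat.factorial_succ]
          push_cast at hρ' hρu ⊢
          linear_combination (ρ (u⁻¹ : Oˣ) * -((e : k) + 1)) * hρ' - hρu
    intro a b c d e ha hb hc hd he hs hs5
    rcases Nat.eq_zero_or_pos e with rfl | he0
    swap
    · obtain ⟨e, rfl⟩ : ∃ f, e = f + 1 := ⟨e - 1, by omega⟩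
      exact key a b c d e ha hb hc hd he hs hs5
    rcases Nat.eq_zero_or_pos a with rfl | ha0
    swap
    · obtain ⟨a, rfl⟩ : ∃ f, a = f + 1 := ⟨a - 1, by omega⟩
      rw [← hrot]
      obtain ⟨w, h1, h2⟩ := key b c d 0 a hb hc hd he ha (by omega) hs5
      exact ⟨w, h1, by rw [← h2]; push_cast; ring⟩
    rcases Nat.eq_zero_or_pos b with rfl | hb0
    swap
    · obtain ⟨b, rfl⟩ : ∃ f, b = f + 1 := ⟨b - 1, by omega⟩
      rw [← hrot, ← hrot]
      obtain ⟨w, h1, h2⟩ := key c d 0 0 b hc hd he ha hb (by omega) hs5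
      exact ⟨w, h1, by rw [← h2]; push_cast; ring⟩
    rcases Nat.eq_zero_or_pos c with rfl | hc0
    swap
    · obtain ⟨c, rfl⟩ : ∃ f, c = f + 1 := ⟨c - 1, by omega⟩
      rw [← hrot, ← hrot, ← hrot]
      obtain ⟨w, h1, h2⟩ := key d 0 0 0 c hd he ha hb hc (by omega) hs5
      exact ⟨w, h1, by rw [← h2]; push_cast; ring⟩
    obtain ⟨d, rfl⟩ : ∃ f, d = f + 1 := ⟨d - 1, by omega⟩
    rw [← hrot, ← hrot, ← hrot, ← hrot]
    obtain ⟨w, h1, h2⟩ := key 0 0 0 0 d he ha hb hc hd (by omega) hs5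
    exact ⟨w, h1, by rw [← h2]; push_cast; ring⟩

end GaussSumCongruence

lemma sum_dig_lt {p : ℕ} (hp : 2 ≤ p) (n : ℕ) : ∑ i, dig p n i < 5 * (p - 1) := by
  have h := fun i => dig_lt hp n i
  have h0 := h 0
  have h1 := h 1
  have h2 := h 2
  have h3 := h 3
  have h4 := h 4
  by_contra hs
  simp only [Fin.sum_univ_five] at hs
  have hr := res_eq_sum_dig hp n 0
  have hlt := res_lt hp n 0
  have hN := modulus_add_one hp
  simp only [zero_add] at hr
  obtain ⟨q, rfl⟩ : ∃ q, p = q + 1 := ⟨p - 1, by omega⟩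
  obtain ⟨e0, e1, e2, e3, e4⟩ : dig (q + 1) n 0 = q ∧ dig (q + 1) n 1 = q ∧
      dig (q + 1) n 2 = q ∧ dig (q + 1) n 3 = q ∧ dig (q + 1) n 4 = q := by omega
  rw [e0, e1, e2, e3, e4] at hr
  have : q * (q + 1) ^ 4 + q * (q + 1) ^ 3 + q * (q + 1) ^ 2 + q * (q + 1) + q + 1
      = (q + 1) ^ 5 := by ring
  omega

section GaussSumCongruence

variable {E O k : Type*} [Field E] [Fintype E] [CommRing O] [IsDomain O] [Field k]

theorem mulChar_pow_congr {p : ℕ} (hp : p.Prime) (hE : Fintype.card E = p ^ 5) (S : MulChar E O)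
    {a b : ℕ} (h : a ≡ b [MOD modulus p]) : S ^ a = S ^ b := by
  have h1 := MulChar.pow_card_eq_one S
  rw [Fintype.card_units, card_sub_one_eq_modulus hp hE] at h1
  exact pow_eq_pow_iff_modEq.mpr (h.of_dvd (orderOf_dvd_of_pow_eq_one h1))

theorem exists_gaussSum_pow_eq {p : ℕ} [Fact p.Prime] [Algebra (ZMod p) E]
    (hE : Fintype.card E = p ^ 5) {ρ : O →+* k} [IsLocalHom ρ] {ι : E →+* k} {S : MulChar E O}
    (hS : ∀ x, ρ (S x) = ι x⁻¹) {ψ : AddChar E O} {ϖ : O}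
    (hψ1 : ψ ≠ 1) (hψp : ∀ x, ψ (x ^ p) = ψ x)
    (hψ : ∀ x, ∃ y, ψ x = 1 + ϖ * y ∧
      ρ y = ι (algebraMap (ZMod p) E (Algebra.trace (ZMod p) E x))) (n : ℕ) :
    ∃ w, gaussSum (S ^ n) ψ = ϖ ^ (∑ i, dig p n i) * w ∧
      ρ w * ((∏ i, (dig p n i).factorial : ℕ) : k) = -1 := by
  have hp : p.Prime := Fact.out
  have hlt := sum_dig_lt hp.two_le n
  obtain ⟨w, h1, h2⟩ := stickelberger_congruence hE hS hψ1 hψp hψ (∑ i, dig p n i)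
    _ _ _ _ _ (dig_lt hp.two_le n 0) (dig_lt hp.two_le n 1) (dig_lt hp.two_le n 2)
    (dig_lt hp.two_le n 3) (dig_lt hp.two_le n 4) (Fin.sum_univ_five _).symm hlt
  refine ⟨w, ?_, by rw [Fin.prod_univ_five]; exact h2⟩
  rw [← h1, mulChar_pow_congr hp hE S (modEq_sum_dig hp.two_le n)]

theorem dig_eq_of_gaussSum_eq {p : ℕ} [Fact p.Prime] [Algebra (ZMod p) E]
    (hE : Fintype.card E = p ^ 5) {ρ : O →+* k} [IsLocalHom ρ] {ι : E →+* k} {S : MulChar E O}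
    (hS : ∀ x, ρ (S x) = ι x⁻¹) {ψ : AddChar E O} {ϖ : O} (hϖ : ϖ ≠ 0) (hρϖ : ρ ϖ = 0)
    (hψ1 : ψ ≠ 1) (hψp : ∀ x, ψ (x ^ p) = ψ x)
    (hψ : ∀ x, ∃ y, ψ x = 1 + ϖ * y ∧
      ρ y = ι (algebraMap (ZMod p) E (Algebra.trace (ZMod p) E x))) {a b : ℕ}
    (hab : gaussSum (S ^ a) ψ = gaussSum (S ^ b) ψ) :
    ∑ i, dig p a i = ∑ i, dig p b i ∧
      ((∏ i, (dig p a i).factorial : ℕ) : ZMod p) = (∏ i, (dig p b i).factorial : ℕ) := by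
  have : CharP E p := charP_of_injective_algebraMap (algebraMap (ZMod p) E).injective p
  have : CharP k p := charP_of_injective_ringHom ι.injective p
  have key : ∀ {s t : ℕ} {v w : O}, s < t → ρ v ≠ 0 → ϖ ^ s * v ≠ ϖ ^ t * w := by
    intro s t v w hst hv h
    obtain ⟨d, rfl⟩ := Nat.exists_eq_add_of_lt hst
    rw [add_assoc, pow_add, mul_assoc, mul_right_inj' (pow_ne_zero s hϖ)] at h
    exact hv (by rw [h, map_mul, map_pow, hρϖ, zero_pow (by omega), zero_mul])
  obtain ⟨v, hv, hv'⟩ := exists_gaussSum_pow_eq hE hS hψ1 hψp hψ a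
  obtain ⟨w, hw, hw'⟩ := exists_gaussSum_pow_eq hE hS hψ1 hψp hψ b
  have hv0 : ρ v ≠ 0 := fun h => by simp [h] at hv'
  have hw0 : ρ w ≠ 0 := fun h => by simp [h] at hw'
  rw [hv, hw] at hab
  have hs : ∑ i, dig p a i = ∑ i, dig p b i := by
    rcases lt_trichotomy (∑ i, dig p a i) (∑ i, dig p b i) with h | h | h
    · exact absurd hab (key h hv0)
    · exact h
    · exact absurd hab.symm (key h hw0)
  refine ⟨hs, ?_⟩
  rw [hs, mul_right_inj' (pow_ne_zero _ hϖ)] at hab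
  rw [hab, ← hw', mul_right_inj' hw0, CharP.natCast_eq_natCast k p] at hv'
  exact (ZMod.natCast_eq_natCast_iff _ _ _).mpr hv'

end GaussSumCongruence

theorem exists_valuationSubring {p : ℕ} (hp : p.Prime) :
    ∃ V : ValuationSubring ℂ, CharP (IsLocalRing.ResidueField V) p := by
  let A : Subring ℂ := (Int.castRingHom ℂ).range
  let P : A := ⟨p, ⟨p, by simp⟩⟩
  have hI : Ideal.span {P} ≠ ⊤ := by
    rw [Ne, Ideal.span_singleton_eq_top]
    intro hu
    obtain ⟨⟨c, m, hm⟩, hc⟩ := hu.exists_right_inv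
    have hc' : (p : ℂ) * c = 1 := congrArg Subtype.val hc
    rw [← hm] at hc'
    have h1 : (p : ℤ) * m = 1 := by
      have : (((p : ℤ) * m : ℤ) : ℂ) = 1 := by simpa using hc'
      exact_mod_cast this
    have h2 := Int.isUnit_iff.mp (IsUnit.of_mul_eq_one _ h1)
    have := hp.two_le
    omega
  obtain ⟨V, hV, hV'⟩ := Ideal.image_subset_nonunits_valuationSubring _ hI
  refine ⟨V, ?_⟩
  have hpV : (p : ℂ) ∈ V.nonunits := hV' ⟨P, Ideal.subset_span rfl, rfl⟩
  have h0 : ((p : ℕ) : IsLocalRing.ResidueField V) = 0 := by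
    rw [← map_natCast (IsLocalRing.residue V), IsLocalRing.residue_eq_zero_iff]
    obtain ⟨h1, h2⟩ := ValuationSubring.mem_nonunits_iff_exists_mem_maximalIdeal.mp hpV
    exact h2
  exact ringChar.of_eq (CharP.ringChar_of_prime_eq_zero hp h0)

theorem ValuationSubring.mem_of_pow_eq_one {K : Type*} [Field K] (V : ValuationSubring K) {x : K}
    {n : ℕ} (hn : n ≠ 0) (hx : x ^ n = 1) : x ∈ V := by
  rcases V.mem_or_inv_mem x with h | h
  · exact h
  · have h1 : x = (x⁻¹) ^ (n - 1) := by
      have hx0 : x ≠ 0 := by rintro rfl; simp [hn] at hx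
      rw [inv_pow]
      refine eq_inv_of_mul_eq_one_right ?_
      rw [← pow_succ, Nat.sub_add_cancel (by omega), hx]
    rw [h1]
    exact pow_mem h _

theorem IsPrimitiveRoot.map_of_cast_ne_zero {O k : Type*} [CommRing O] [IsDomain O] [Field k]
    (ρ : O →+* k) {ζ : O} {n : ℕ} (hζ : IsPrimitiveRoot ζ n) (hn : (n : k) ≠ 0) :
    IsPrimitiveRoot (ρ ζ) n := by
  refine ⟨by rw [← map_pow, hζ.pow_eq_one, map_one], fun l hl => ?_⟩
  by_contra hdvd
  have h1 : ζ ^ l ≠ 1 := fun h => hdvd (hζ.dvd_of_pow_eq_one l h)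
  have h2 : ∑ i ∈ Finset.range n, (ζ ^ l) ^ i = 0 := by
    refine (mul_eq_zero.mp ?_).resolve_left (sub_ne_zero.mpr h1)
    rw [mul_geom_sum, ← pow_mul, mul_comm, pow_mul, hζ.pow_eq_one, one_pow, sub_self]
  have h3 := congrArg ρ h2
  rw [map_sum, map_zero] at h3
  simp only [map_pow, hl, one_pow, Finset.sum_const, Finset.card_range, nsmul_eq_mul, mul_one]
    at h3
  exact hn h3

theorem exists_teichmuller {p : ℕ} (hp : p.Prime) {E : Type*} [Field E] [Fintype E]
    (hE : Fintype.card E = p ^ 5) {O k : Type*} [CommRing O] [IsDomain O] [Field k] [CharP k p]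
    (ρ : O →+* k) (ι : E →+* k) {ζ : O} (hζ : IsPrimitiveRoot ζ (modulus p)) :
    ∃ S : MulChar E O, ∀ x, ρ (S x) = ι x⁻¹ := by
  have hN := two_lt_modulus hp.two_le
  have : NeZero (modulus p) := ⟨by omega⟩
  obtain ⟨g, hg⟩ := IsCyclic.exists_generator (α := Eˣ)
  have ho : orderOf g = modulus p := by
    rw [orderOf_eq_card_of_forall_mem_zpowers hg, Nat.card_eq_fintype_card, Fintype.card_units,
      card_sub_one_eq_modulus hp hE]
  have hz := hζ.map_of_cast_ne_zero ρ (by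
    rw [cast_modulus_eq_neg_one (E := k) hp]
    exact neg_ne_zero.mpr one_ne_zero)
  have hgN : (g : E) ^ modulus p = 1 := by
    rw [← ho, ← Units.val_pow_eq_pow_val, pow_orderOf_eq_one, Units.val_one]
  obtain ⟨m, -, hm⟩ := hz.eq_pow_of_pow_eq_one (ξ := ι (g : E)⁻¹)
    (by rw [← map_pow, inv_pow, hgN, inv_one, map_one])
  obtain ⟨u, hu⟩ := hζ.isUnit (by omega)
  have hu' : orderOf (u ^ m) ∣ orderOf g := by
    rw [ho]
    refine orderOf_dvd_of_pow_eq_one (Units.ext ?_)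
    push_cast
    rw [hu, ← pow_mul, mul_comm, pow_mul, hζ.pow_eq_one, one_pow]
  let f : Eˣ →* Oˣ := monoidHomOfForallMemZpowers hg hu'
  have hf : f g = u ^ m := monoidHomOfForallMemZpowers_apply_gen hg hu'
  refine ⟨MulChar.ofUnitHom f, fun x => ?_⟩
  by_cases hx : x = 0
  · rw [hx, MulChar.map_zero, map_zero, inv_zero, map_zero]
  · obtain ⟨x, rfl⟩ := (isUnit_iff_ne_zero.mpr hx)
    have hhom : (Units.map (ρ : O →* k)).comp f =
        (Units.map (ι : E →* k)).comp (invMonoidHom) := by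
      refine MonoidHom.ext fun y => ?_
      obtain ⟨i, rfl⟩ := Subgroup.mem_zpowers_iff.mp (hg y)
      rw [map_zpow, map_zpow]
      congr 1
      ext
      simp [hf, hu, hm]
    have := congrArg Units.val (DFunLike.congr_fun hhom x)
    rw [MulChar.ofUnitHom_coe]
    simpa using this

theorem exists_char_dig_eq {p : ℕ} [Fact p.Prime] {E : Type*} [Field E] [Fintype E]
    [Algebra (ZMod p) E] (hE : Fintype.card E = p ^ 5) {ψ : AddChar (ZMod p) ℂ} (hψ : ψ ≠ 1) :
    ∃ Ω : Eˣ →* ℂˣ, Function.Injective Ω ∧ ∀ a b : ℕ,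
      ∑ x : Eˣ, (Ω x : ℂ) ^ a * ψ (Algebra.trace (ZMod p) E x) =
        ∑ x : Eˣ, (Ω x : ℂ) ^ b * ψ (Algebra.trace (ZMod p) E x) →
      ∑ i, dig p a i = ∑ i, dig p b i ∧
        ((∏ i, (dig p a i).factorial : ℕ) : ZMod p) = (∏ i, (dig p b i).factorial : ℕ) := by
  have hp : p.Prime := Fact.out
  have hN := two_lt_modulus hp.two_le
  obtain ⟨V, hV⟩ := exists_valuationSubring hp
  let k := AlgebraicClosure (IsLocalRing.ResidueField V)
  let ρ : V →+* k := (algebraMap (IsLocalRing.ResidueField V) k).comp (IsLocalRing.residue V)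
  have hρ : IsLocalHom ρ := ⟨fun a ha => by
    by_contra h
    have h0 : IsLocalRing.residue V a = 0 :=
      (IsLocalRing.residue_eq_zero_iff a).mpr ((IsLocalRing.mem_maximalIdeal a).mpr h)
    refine ha.ne_zero ?_
    rw [RingHom.comp_apply, h0, map_zero]⟩
  have : CharP k p :=
    charP_of_injective_algebraMap (algebraMap (IsLocalRing.ResidueField V) k).injective p
  let _ : Algebra (ZMod p) k := ZMod.algebra k p
  let ι : E →+* k := (IsAlgClosed.lift : E →ₐ[ZMod p] k).toRingHom
  obtain ⟨ζ, hζ⟩ : ∃ ζ : V, IsPrimitiveRoot ζ (modulus p) := by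
    have h := Complex.isPrimitiveRoot_exp (modulus p) (by omega)
    refine ⟨⟨_, V.mem_of_pow_eq_one (by omega) h.pow_eq_one⟩, ?_⟩
    exact IsPrimitiveRoot.of_map_of_injective (f := V.subtype) h Subtype.val_injective
  obtain ⟨S, hS⟩ := exists_teichmuller hp hE ρ ι hζ
  have hψV : ∀ y, ψ y ∈ V := fun y => V.mem_of_pow_eq_one hp.ne_zero (by
    rw [← AddChar.map_nsmul_eq_pow, nsmul_eq_mul, CharP.cast_eq_zero, zero_mul,
      AddChar.map_zero_eq_one])
  let Ψ : AddChar E V :=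
    { toFun := fun x => ⟨ψ (Algebra.trace (ZMod p) E x), hψV _⟩
      map_zero_eq_one' := by
        ext
        simp
      map_add_eq_mul' := fun x y => by
        ext
        simp [AddChar.map_add_eq_mul] }
  let ϖ : V := ⟨ψ 1, hψV 1⟩ - 1
  have hψval : ∀ y : ZMod p, ψ y = ψ 1 ^ y.val := fun y => by
    rw [← AddChar.map_nsmul_eq_pow, nsmul_eq_mul, mul_one, ZMod.natCast_val, ZMod.cast_id]
  have hψ1 : ψ 1 ≠ 1 := fun h => hψ (by
    ext y
    rw [hψval, h, one_pow, AddChar.one_apply])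
  have hρ1 : ρ ⟨ψ 1, hψV 1⟩ = 1 := by
    have h1 : (ρ ⟨ψ 1, hψV 1⟩) ^ p = 1 := by
      rw [← map_pow, ← map_one ρ]
      congr 1
      ext
      show ψ 1 ^ p = 1
      rw [← AddChar.map_nsmul_eq_pow, nsmul_eq_mul, CharP.cast_eq_zero, zero_mul,
        AddChar.map_zero_eq_one]
    have h2 : (ρ ⟨ψ 1, hψV 1⟩ - 1) ^ p = 0 := by
      rw [sub_pow_char, h1, one_pow, sub_self]
    exact sub_eq_zero.mp (pow_eq_zero_iff hp.ne_zero |>.mp h2)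
  have hϖ : ϖ ≠ 0 := fun h => hψ1 (congrArg Subtype.val (sub_eq_zero.mp h))
  have hρϖ : ρ ϖ = 0 := by rw [map_sub, hρ1, map_one, sub_self]
  have htr : ∃ x : E, Algebra.trace (ZMod p) E x = 1 := Algebra.trace_surjective _ _ 1
  have hΨ1 : Ψ ≠ 1 := fun h => by
    obtain ⟨x, hx⟩ := htr
    have h1 := congrArg Subtype.val (DFunLike.congr_fun h x)
    refine hψ1 ?_
    rw [← hx]
    exact h1
  have hΨp : ∀ x, Ψ (x ^ p) = Ψ x := fun x => by
    ext
    show ψ (Algebra.trace (ZMod p) E (x ^ p)) = ψ (Algebra.trace (ZMod p) E x)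
    congr 1
    have := Algebra.trace_eq_of_algEquiv (FiniteField.frobeniusAlgEquivOfAlgebraic (ZMod p) E) x
    simpa [FiniteField.coe_frobeniusAlgEquivOfAlgebraic] using this
  have hΨ : ∀ x, ∃ y, Ψ x = 1 + ϖ * y ∧
      ρ y = ι (algebraMap (ZMod p) E (Algebra.trace (ZMod p) E x)) := fun x => by
    set t := Algebra.trace (ZMod p) E x
    refine ⟨∑ i ∈ Finset.range t.val, (⟨ψ 1, hψV 1⟩ : V) ^ i, ?_, ?_⟩
    · rw [mul_geom_sum, add_sub_cancel]
      ext
      exact hψval t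
    · rw [map_sum]
      simp only [map_pow, hρ1, one_pow, Finset.sum_const, Finset.card_range, nsmul_eq_mul, mul_one]
      rw [← map_natCast ι, ← map_natCast (algebraMap (ZMod p) E), ZMod.natCast_val, ZMod.cast_id]
  refine ⟨(Units.map (V.subtype : V →* ℂ)).comp S.toUnitHom, ?_, fun a b hab => ?_⟩
  · rw [MonoidHom.coe_comp]
    refine (Units.map_injective (f := (V.subtype : V →* ℂ)) Subtype.val_injective).comp ?_
    intro x y hxy
    have h1 : S x = S y := by
      rw [← MulChar.coe_toUnitHom, hxy, MulChar.coe_toUnitHom]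
    have h2 := congrArg ρ h1
    rw [hS, hS] at h2
    exact Units.ext (inv_injective (ι.injective h2))
  · refine dig_eq_of_gaussSum_eq hE hS hϖ hρϖ hΨ1 hΨp hΨ (Subtype.val_injective ?_)
    have hsum : ∀ n : ℕ, ((gaussSum (S ^ n) Ψ : V) : ℂ) =
        ∑ x : Eˣ, ((S x : V) : ℂ) ^ n * ψ (Algebra.trace (ZMod p) E x) := by
      intro n
      have h0 : gaussSum (S ^ n) Ψ = ∑ x ∈ ({0}ᶜ : Finset E), (S ^ n) x * Ψ x := by
        refine (Finset.sum_subset (Finset.subset_univ _) fun x _ hx => ?_).symm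
        have : x = 0 := by simpa using hx
        rw [this, MulChar.map_zero, zero_mul]
      rw [h0, ← V.subtype_apply, map_sum]
      refine (Finset.sum_bij (fun (x : Eˣ) _ => (x : E)) ?_ ?_ ?_ ?_).symm
      · simp
      · intro a _ b _ h
        exact Units.ext h
      · intro b hb
        exact ⟨Units.mk0 b (by simpa using hb), by simp, rfl⟩
      · intro x _
        rw [MulChar.pow_apply_coe, map_mul, map_pow]
        rfl
    show ((gaussSum (S ^ a) Ψ : V) : ℂ) = ((gaussSum (S ^ b) Ψ : V) : ℂ)
    rw [hsum, hsum]
    exact hab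

theorem coprime_modulus {p : ℕ} (hp : 2 ≤ p) : Nat.Coprime (modulus p) p := by
  have h : Nat.Coprime (modulus p) (p ^ 5) := by
    rw [← modulus_add_one hp]
    simp
  exact Nat.Coprime.coprime_dvd_right (dvd_pow_self p (by norm_num)) h

theorem IsPrimitiveRoot.sum_pow_mul_eq {ι K : Type*} [Fintype ι] [Field K] [CharZero K] {ξ : K}
    {n : ℕ} (hξ : IsPrimitiveRoot ξ n) (hn : 0 < n) {σ : ℕ} (hσ : σ.Coprime n) (u v : ι → ℕ)
    (h : ∑ i, ξ ^ u i = ∑ i, ξ ^ v i) : ∑ i, ξ ^ (σ * u i) = ∑ i, ξ ^ (σ * v i) := by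
  let P : Polynomial ℤ := ∑ i, Polynomial.X ^ u i - ∑ i, Polynomial.X ^ v i
  have hP : ∀ z : K, Polynomial.aeval z P = ∑ i, z ^ u i - ∑ i, z ^ v i := fun z => by
    simp [P]
  have h0 : Polynomial.aeval ξ P = 0 := by rw [hP, h, sub_self]
  have hdvd := minpoly.isIntegrallyClosed_dvd (hξ.isIntegral hn) h0
  rw [hξ.minpoly_eq_pow_coprime hσ] at hdvd
  obtain ⟨Q, hQ⟩ := hdvd
  have h1 := hP (ξ ^ σ)
  rw [hQ, map_mul, minpoly.aeval, zero_mul, eq_comm, sub_eq_zero] at h1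
  simpa only [pow_mul] using h1

theorem sum_char_pow_mul_eq {p : ℕ} [Fact p.Prime] {E : Type*} [Field E] [Fintype E]
    [Algebra (ZMod p) E] (hE : Fintype.card E = p ^ 5) (ψ : AddChar (ZMod p) ℂ)
    (Ω : Eˣ →* ℂˣ) {τ a b : ℕ} (hτ : τ.Coprime (modulus p))
    (h : ∑ x : Eˣ, (Ω x : ℂ) ^ a * ψ (Algebra.trace (ZMod p) E x) =
      ∑ x : Eˣ, (Ω x : ℂ) ^ b * ψ (Algebra.trace (ZMod p) E x)) :
    ∑ x : Eˣ, (Ω x : ℂ) ^ (τ * a) * ψ (Algebra.trace (ZMod p) E x) =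
      ∑ x : Eˣ, (Ω x : ℂ) ^ (τ * b) * ψ (Algebra.trace (ZMod p) E x) := by
  have hp : p.Prime := Fact.out
  have hN := modulus_pos hp.two_le
  have hn : 0 < modulus p * p := Nat.mul_pos hN hp.pos
  have : NeZero (modulus p * p) := ⟨hn.ne'⟩
  obtain ⟨σ, hσN, hσp⟩ := Nat.chineseRemainder (coprime_modulus hp.two_le) τ 1
  have hσ : σ.Coprime (modulus p * p) := by
    refine Nat.Coprime.mul_right ?_ ?_
    · rw [Nat.Coprime, hσN.gcd_eq]; exact hτ
    · rw [Nat.Coprime, hσp.gcd_eq]; simp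
  have hξ := Complex.isPrimitiveRoot_exp (modulus p * p) hn.ne'
  set ξ := Complex.exp (2 * Real.pi * Complex.I / (modulus p * p : ℕ))
  have hΩ : ∀ x, (Ω x : ℂ) ^ modulus p = 1 := fun x => by
    rw [← card_sub_one_eq_modulus hp hE, ← Fintype.card_units, ← Units.val_pow_eq_pow_val,
      ← map_pow, pow_card_eq_one, map_one, Units.val_one]
  have hψ : ∀ t, ψ t ^ p = 1 := fun t => by
    rw [← AddChar.map_nsmul_eq_pow, nsmul_eq_mul, CharP.cast_eq_zero, zero_mul,
      AddChar.map_zero_eq_one]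
  have hu : ∀ x : Eˣ, ∃ u : ℕ, ξ ^ u = Ω x := fun x => by
    obtain ⟨u, -, hu⟩ := hξ.eq_pow_of_pow_eq_one (ξ := (Ω x : ℂ))
      (by rw [pow_mul, hΩ, one_pow])
    exact ⟨u, hu⟩
  have hv : ∀ x : Eˣ, ∃ v : ℕ, ξ ^ v = ψ (Algebra.trace (ZMod p) E x) := fun x => by
    obtain ⟨v, -, hv⟩ := hξ.eq_pow_of_pow_eq_one (ξ := ψ (Algebra.trace (ZMod p) E x))
      (by rw [mul_comm, pow_mul, hψ, one_pow])
    exact ⟨v, hv⟩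
  choose u hu using hu
  choose v hv using hv
  have hσΩ : ∀ x, (Ω x : ℂ) ^ σ = (Ω x : ℂ) ^ τ := fun x => by
    rw [pow_eq_pow_mod σ (hΩ x), hσN, ← pow_eq_pow_mod τ (hΩ x)]
  have hσψ : ∀ t, ψ t ^ σ = ψ t := fun t => by
    rw [pow_eq_pow_mod σ (hψ t), hσp, ← pow_eq_pow_mod 1 (hψ t), pow_one]
  have hpow : ∀ c x, ξ ^ (u x * c + v x) = (Ω x : ℂ) ^ c * ψ (Algebra.trace (ZMod p) E x) :=
    fun c x => by rw [pow_add, pow_mul, hu, hv]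
  have hpow' : ∀ c x, ξ ^ (σ * (u x * c + v x)) =
      (Ω x : ℂ) ^ (τ * c) * ψ (Algebra.trace (ZMod p) E x) := fun c x => by
    rw [mul_comm, pow_mul, hpow, mul_pow, hσψ, ← pow_mul, mul_comm c, pow_mul, hσΩ, pow_mul]
  have key := hξ.sum_pow_mul_eq hn hσ (fun x => u x * a + v x) (fun x => u x * b + v x)
  simp only [hpow, hpow'] at key
  exact key h

theorem nat_card_fieldRange {p : ℕ} [Fact p.Prime] {E : Type*} [Field E] [Algebra (ZMod p) E] :
    Nat.card (algebraMap (ZMod p) E).fieldRange = p := by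
  have h := Nat.card_congr (algebraMap (ZMod p) E).rangeRestrictFieldEquiv.toEquiv
  rw [← h, Nat.card_zmod]

theorem modulus_div {p : ℕ} (hp : 2 ≤ p) : (p ^ 5 - 1) / (p - 1) = repunit p := by
  rw [← modulus_add_one hp, Nat.add_sub_cancel, modulus, Nat.mul_div_cancel_left _ (by omega)]

theorem repunit_dvd_of_not_injective {p n : ℕ} (hp : 2 ≤ p) (h : ¬ (res p n).Injective) :
    repunit p ∣ n := by
  have hstep : ∀ d, p ^ d * n ≡ n [MOD modulus p] → ∀ m, p ^ (d * m) * n ≡ n [MOD modulus p] := by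
    intro d hd m
    induction m with
    | zero => simp; rfl
    | succ m ih =>
      rw [Nat.mul_succ, pow_add, mul_assoc]
      exact (hd.mul_left _).trans ih
  have hlt : ∀ i j : Fin 5, i < j → res p n i = res p n j → repunit p ∣ n := by
    intro i j hij he
    obtain ⟨d, hd, hd0⟩ : ∃ d : ℕ, (j : ℕ) = i + d ∧ d ≠ 0 := by
      have : (i : ℕ) < j := hij
      exact ⟨j - i, by omega, by omega⟩
    have h1 : p ^ (i : ℕ) * n ≡ p ^ (i : ℕ) * (p ^ d * n) [MOD modulus p] := by
      rw [← mul_assoc, ← pow_add, ← hd]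
      exact he
    have h2 : p ^ d * n ≡ n [MOD modulus p] :=
      (Nat.ModEq.cancel_left_of_coprime ((coprime_modulus hp).pow_right _) h1).symm
    have h3 : p ^ 1 * n ≡ n [MOD modulus p] := by
      have hd5 : d < 5 := by omega
      have hm : ∃ m, d * m % 5 = 1 := by
        interval_cases d
        · exact absurd rfl hd0
        · exact ⟨1, rfl⟩
        · exact ⟨3, rfl⟩
        · exact ⟨2, rfl⟩
        · exact ⟨4, rfl⟩
      obtain ⟨m, hm⟩ := hm
      have := (pow_mod_five hp (d * m)).mul_right n
      rw [hm] at this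
      exact this.trans (hstep d h2 m)
    have h4 : modulus p ∣ p ^ 1 * n - n :=
      (Nat.modEq_iff_dvd' (Nat.le_mul_of_pos_left _ (by positivity))).mp h3.symm
    rw [pow_one, ← Nat.sub_one_mul, modulus] at h4
    exact Nat.dvd_of_mul_dvd_mul_left (by omega) h4
  simp only [Function.Injective, not_forall] at h
  obtain ⟨i, j, he, hij⟩ := h
  rcases lt_or_gt_of_ne hij with h' | h'
  · exact hlt i j h' he
  · exact hlt j i h' he.symm

theorem IsRegularChar.res_injective {p : ℕ} [Fact p.Prime] {E : Type} [Field E] [Fintype E]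
    [Algebra (ZMod p) E] (hE : Fintype.card E = p ^ 5) {Ω : Eˣ →* ℂˣ} {n : ℕ}
    (h : IsRegularChar (Ω ^ n)) : (res p n).Injective := by
  have hp : p.Prime := Fact.out
  by_contra hinj
  obtain ⟨c, rfl⟩ := repunit_dvd_of_not_injective hp.two_le hinj
  set K := (algebraMap (ZMod p) E).fieldRange
  have hK : Nat.card K = p := nat_card_fieldRange
  refine h K ?_ ⟨(Ω.comp (Units.map (K.subtype : K →* E))) ^ c, fun x => ?_⟩
  · intro htop
    have h1 : Nat.card K = Nat.card E := by
      rw [htop]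
      exact Nat.card_congr Subfield.topEquiv.toEquiv
    rw [hK, Nat.card_eq_fintype_card, hE] at h1
    have := Nat.pow_right_injective hp.two_le (show p ^ 1 = p ^ 5 by rw [pow_one]; exact h1)
    omega
  · have hnorm : Units.map (K.subtype : K →* E) (Units.map (Algebra.norm K : E →* K) x) =
        x ^ repunit p := by
      ext
      have := FiniteField.algebraMap_norm_eq_pow (K := K) (K' := E) (x := (x : E))
      rw [hK, Nat.card_eq_fintype_card, hE, modulus_div hp.two_le] at this
      rw [Units.val_pow_eq_pow_val, ← this]
      rfl
    rw [MonoidHom.pow_apply, MonoidHom.pow_apply, MonoidHom.comp_apply, hnorm, map_pow, pow_mul]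

theorem twistedGaussSum_pow_eq {p : ℕ} [Fact p.Prime] {E : Type} [Field E] [Fintype E]
    [Algebra (ZMod p) E] (hE : Fintype.card E = p ^ 5) (Ω : Eˣ →* ℂˣ) (n k : ℕ)
    (ψ : AddChar (ZMod p) ℂ) :
    twistedGaussSum (ZMod p) (Ω ^ n)
        ((Ω.comp (Units.map (algebraMap (ZMod p) E : ZMod p →* E))) ^ k) ψ =
      ∑ x : Eˣ, (Ω x : ℂ) ^ (n + k * repunit p) * ψ (Algebra.trace (ZMod p) E x) := by
  have hp : p.Prime := Fact.out
  refine Finset.sum_congr rfl fun x _ => ?_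
  have hnorm : Units.map (algebraMap (ZMod p) E : ZMod p →* E)
      (Units.map (Algebra.norm (ZMod p) : E →* ZMod p) x) = x ^ repunit p := by
    ext
    have := FiniteField.algebraMap_norm_eq_pow (K := ZMod p) (K' := E) (x := (x : E))
    rw [Nat.card_zmod, Nat.card_eq_fintype_card, hE, modulus_div hp.two_le] at this
    simpa using this
  rw [MonoidHom.pow_apply, MonoidHom.pow_apply, MonoidHom.comp_apply, hnorm, map_pow, pow_add,
    mul_comm k, pow_mul]
  push_cast
  rfl

theorem exists_eq_pow_of_injective {p : ℕ} (hp : p.Prime) {E : Type*} [Field E] [Fintype E]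
    (hE : Fintype.card E = p ^ 5) {Ω : Eˣ →* ℂˣ} (hΩ : Function.Injective Ω) (χ : Eˣ →* ℂˣ) :
    ∃ n : ℕ, χ = Ω ^ n := by
  have hN := modulus_pos hp.two_le
  have : NeZero (modulus p) := ⟨hN.ne'⟩
  obtain ⟨g, hg⟩ := IsCyclic.exists_generator (α := Eˣ)
  have ho : orderOf g = modulus p := by
    rw [orderOf_eq_card_of_forall_mem_zpowers hg, Nat.card_eq_fintype_card, Fintype.card_units,
      card_sub_one_eq_modulus hp hE]
  have hζ : IsPrimitiveRoot (Ω g) (modulus p) := by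
    rw [← ho, ← orderOf_injective Ω hΩ g]
    exact IsPrimitiveRoot.orderOf _
  obtain ⟨n, -, hn⟩ := (IsPrimitiveRoot.coe_units_iff.mpr hζ).eq_pow_of_pow_eq_one
    (ξ := (χ g : ℂ)) (by
      rw [← ho, ← Units.val_pow_eq_pow_val, ← map_pow, pow_orderOf_eq_one, map_one, Units.val_one])
  refine ⟨n, MonoidHom.ext fun x => ?_⟩
  obtain ⟨i, rfl⟩ := Subgroup.mem_zpowers_iff.mp (hg x)
  rw [map_zpow, map_zpow]
  congr 1
  ext
  rw [MonoidHom.pow_apply, Units.val_pow_eq_pow_val, hn]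

theorem gauss_sum_converse_GL_five
    (p : ℕ) [hp : Fact p.Prime]
    (E : Type) [Field E] [Fintype E] [Algebra (ZMod p) E]
    (hE : Fintype.card E = p ^ 5)
    (ψ : AddChar (ZMod p) ℂ) (hψ : ψ ≠ 1)
    (χ₁ χ₂ : Eˣ →* ℂˣ) (hχ₁ : IsRegularChar χ₁) (hχ₂ : IsRegularChar χ₂)
    (h : ∀ η : (ZMod p)ˣ →* ℂˣ,
      twistedGaussSum (ZMod p) χ₁ η ψ = twistedGaussSum (ZMod p) χ₂ η ψ) :
    ∃ j : ℕ, ∀ x : Eˣ, χ₁ x = χ₂ (x ^ p ^ j) := by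
  obtain ⟨Ω, hΩ, hdig⟩ := exists_char_dig_eq hE hψ
  obtain ⟨a, rfl⟩ := exists_eq_pow_of_injective hp.out hE hΩ χ₁
  obtain ⟨b, rfl⟩ := exists_eq_pow_of_injective hp.out hE hΩ χ₂
  have hab : DigitData p a b := fun τ k hτ => by
    refine hdig _ _ (sum_char_pow_mul_eq hE ψ Ω hτ ?_)
    rw [← twistedGaussSum_pow_eq hE, ← twistedGaussSum_pow_eq hE, h]
  obtain ⟨j, hj⟩ := hab.exists_modEq hp.out (hχ₁.res_injective hE) (hχ₂.res_injective hE)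
  refine ⟨j, fun x => ?_⟩
  rw [MonoidHom.pow_apply, MonoidHom.pow_apply, map_pow, ← pow_mul, pow_eq_pow_iff_modEq]
  refine hj.of_dvd (orderOf_dvd_of_pow_eq_one ?_)
  rw [← map_pow, ← card_sub_one_eq_modulus hp.out hE, ← Fintype.card_units, pow_card_eq_one,
    map_one]
end

section
/- Let t ≥ 3 be an integer such that φ(3^t + 1) ≥ 4t, where φ is the Euler totient function, and let ψ : F_3 → ℂˣ be a nontrivial additive character. Then there exist regular multiplicative characters χ₁, χ₂ : F_{3^(2t)}ˣ → ℂˣ, each of order 3^t + 1, which are NOT Frobenius-equivalent (for every integer j there exists x ∈ F_{3^(2t)}ˣ with χ₁(x) ≠ χ₂(x^(3^j))), and yet G(χ₁·η, ψ) = G(χ₂·η, ψ) for every multiplicative character η : F_3ˣ → ℂˣ. (In particular, the n×1 local converse statement over finite fields fails for n = 2t ≥ 6 and q = 3.) -/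
open scoped Classical

section FiniteField

open Finset

theorem pow_prime_pow_pow_prime_pow {p : ℕ} {E : Type} [Field E] [Fintype E] {t : ℕ}
    (hE : Fintype.card E = p ^ (2 * t)) (x : E) : (x ^ p ^ t) ^ p ^ t = x := by
  rw [← pow_mul, ← pow_add, ← two_mul, ← hE, FiniteField.pow_card]

variable {p : ℕ} [Fact p.Prime] {E : Type} [Field E] [Algebra (ZMod p) E]

variable (p E) in
/-- The elements of `E` fixed by the `t`-th power of Frobenius. -/
def frobeniusFixed (t : ℕ) : AddSubgroup E where
  carrier := {a | a ^ p ^ t = a}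
  zero_mem' := zero_pow (pow_ne_zero _ (Fact.out : p.Prime).ne_zero)
  add_mem' {a b} ha hb := by
    have : CharP E p := charP_of_injective_algebraMap (algebraMap (ZMod p) E).injective p
    simp only [Set.mem_ofPred_eq] at ha hb ⊢
    rw [add_pow_char_pow, ha, hb]
  neg_mem' {a} ha := by
    have : CharP E p := charP_of_injective_algebraMap (algebraMap (ZMod p) E).injective p
    simp only [Set.mem_ofPred_eq] at ha ⊢
    have h := sub_pow_char_pow (p := p) (n := t) (0 : E) a
    rwa [zero_sub, zero_pow (pow_ne_zero _ (Fact.out : p.Prime).ne_zero), ha, zero_sub] at h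

theorem mem_frobeniusFixed {t : ℕ} {a : E} : a ∈ frobeniusFixed p E t ↔ a ^ p ^ t = a := Iff.rfl

variable [Fintype E]

theorem trace_pow_prime_pow (k : ℕ) (x : E) :
    Algebra.trace (ZMod p) E (x ^ p ^ k) = Algebra.trace (ZMod p) E x := by
  induction k with
  | zero => simp
  | succ k ih =>
    rw [pow_succ, pow_mul, ← ih]
    have h := Algebra.trace_eq_of_algEquiv
      (FiniteField.frobeniusAlgEquivOfAlgebraic (ZMod p) E) (x ^ p ^ k)
    simpa [FiniteField.coe_frobeniusAlgEquivOfAlgebraic] using h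

theorem trace_mul_frobeniusFixed_eq_zero_iff (hp : p ≠ 2) {t : ℕ}
    (hE : Fintype.card E = p ^ (2 * t)) (x : E) :
    (∀ a ∈ frobeniusFixed p E t, Algebra.trace (ZMod p) E (a * x) = 0) ↔ x ^ p ^ t = -x := by
  constructor
  · intro h
    have key (b : E) : Algebra.trace (ZMod p) E ((x + x ^ p ^ t) * b) = 0 := by
      have hb : b + b ^ p ^ t ∈ frobeniusFixed p E t := by
        have : CharP E p := charP_of_injective_algebraMap (algebraMap (ZMod p) E).injective p
        rw [mem_frobeniusFixed, add_pow_char_pow, pow_prime_pow_pow_prime_pow hE, add_comm]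
      have hs := trace_pow_prime_pow (p := p) t (b ^ p ^ t * x)
      rw [mul_pow, pow_prime_pow_pow_prime_pow hE] at hs
      have h0 := h _ hb
      rw [add_mul, map_add, ← hs, ← map_add] at h0
      rw [← h0]
      ring_nf
    have hx := (traceForm_nondegenerate (ZMod p) E).1 (x + x ^ p ^ t) key
    exact eq_neg_of_add_eq_zero_right hx
  · intro hx a ha
    have hs := trace_pow_prime_pow (p := p) t (a * x)
    rw [mul_pow, mem_frobeniusFixed.1 ha, hx, mul_neg, map_neg] at hs
    have : Fact (2 < p) := ⟨(Fact.out : p.Prime).two_le.lt_of_ne' hp⟩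
    exact ZMod.neg_eq_self_iff _ |>.1 hs |>.resolve_right fun h => by
      have := (Fact.out : p.Prime).eq_one_or_self_of_dvd 2 ⟨_, h.symm⟩
      omega

theorem sum_addChar_trace_frobeniusFixed (hp : p ≠ 2) {t : ℕ}
    (hE : Fintype.card E = p ^ (2 * t)) {ψ : AddChar (ZMod p) ℂ} (hψ : ψ ≠ 1) (x : E) :
    ∑ a : frobeniusFixed p E t, ψ (Algebra.trace (ZMod p) E (a * x)) =
      if x ^ p ^ t = -x then (Fintype.card (frobeniusFixed p E t) : ℂ) else 0 := by
  let f : frobeniusFixed p E t →+ ZMod p :=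
    (Algebra.trace (ZMod p) E).toAddMonoidHom.comp
      ((AddMonoidHom.mulRight x).comp (frobeniusFixed p E t).subtype)
  have hf (a : frobeniusFixed p E t) : f a = Algebra.trace (ZMod p) E (a * x) := rfl
  have hzero : ψ.compAddMonoidHom f = 0 ↔ x ^ p ^ t = -x := by
    rw [← trace_mul_frobeniusFixed_eq_zero_iff hp hE x]
    constructor
    · intro h a ha
      by_contra hne
      obtain ⟨z, hz⟩ := AddChar.ne_one_iff.1 (AddChar.IsPrimitive.of_ne_one hψ hne)
      refine hz ?_
      have h1 := DFunLike.congr_fun h (z.val • (⟨a, ha⟩ : frobeniusFixed p E t))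
      rw [AddChar.compAddMonoidHom_apply, map_nsmul, hf] at h1
      rw [AddChar.mulShift_apply, mul_comm]
      simpa using h1
    · intro h
      ext a
      rw [AddChar.compAddMonoidHom_apply, hf, h a a.2]
      simp
  have := AddChar.sum_eq_ite (ψ.compAddMonoidHom f)
  simp only [hzero, AddChar.compAddMonoidHom_apply, hf] at this
  exact this

/-- Stickelberger-type evaluation of the Gauss sum of a nontrivial character that is trivial on
the units of the subfield of index two. -/
theorem card_sub_one_mul_sum_eq (hp : p ≠ 2) {t : ℕ}
    (hE : Fintype.card E = p ^ (2 * t)) {ψ : AddChar (ZMod p) ℂ} (hψ : ψ ≠ 1)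
    {θ : Eˣ →* ℂˣ} (hθ : θ ≠ 1) (hfix : ∀ u : Eˣ, (u : E) ^ p ^ t = u → θ u = 1) :
    ((Fintype.card (frobeniusFixed p E t) : ℂ) - 1) *
        ∑ x : Eˣ, (θ x : ℂ) * ψ (Algebra.trace (ZMod p) E x) =
      Fintype.card (frobeniusFixed p E t) * ∑ x ∈ univ.filter (fun x : Eˣ => (x : E) ^ p ^ t = -x), (θ x : ℂ) := by
  have hsum : ∑ x : Eˣ, (θ x : ℂ) = 0 := by
    refine sum_hom_units_eq_zero ((Units.coeHom ℂ).comp θ) fun h => hθ ?_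
    ext x
    exact DFunLike.congr_fun h x
  have hinner (a : frobeniusFixed p E t) :
      ∑ x : Eˣ, (θ x : ℂ) * ψ (Algebra.trace (ZMod p) E (a * x)) =
        if a = 0 then 0 else ∑ x : Eˣ, (θ x : ℂ) * ψ (Algebra.trace (ZMod p) E x) := by
    split_ifs with ha
    · simp [ha, hsum]
    · have ha' : (a : E) ≠ 0 := by simpa using ha
      refine Fintype.sum_equiv (Equiv.mulLeft (Units.mk0 (a : E) ha')) _ _ fun x => ?_
      simp [hfix (Units.mk0 (a : E) ha') a.2]
  have hdouble : ∑ a : frobeniusFixed p E t,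
      ∑ x : Eˣ, (θ x : ℂ) * ψ (Algebra.trace (ZMod p) E (a * x)) =
        ∑ x : Eˣ, (θ x : ℂ) *
          if (x : E) ^ p ^ t = -x then (Fintype.card (frobeniusFixed p E t) : ℂ) else 0 := by
    rw [sum_comm]
    simp_rw [← mul_sum, sum_addChar_trace_frobeniusFixed hp hE hψ]
  simp_rw [hinner, mul_ite, mul_zero, ← sum_filter, ← sum_mul] at hdouble
  rw [mul_comm (Fintype.card (frobeniusFixed p E t) : ℂ), ← hdouble, ← sub_eq_zero]
  have hite : ∑ a : frobeniusFixed p E t, (if a = 0 then (1 : ℂ) else 0) = 1 := by simp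
  have hrw (S : ℂ) : ∑ a : frobeniusFixed p E t, (if a = 0 then 0 else S) =
      ((Fintype.card (frobeniusFixed p E t) : ℂ) - 1) * S := by
    have (a : frobeniusFixed p E t) : (if a = 0 then 0 else S) =
        S - (if a = 0 then (1 : ℂ) else 0) * S := by split_ifs <;> simp
    simp_rw [this, sum_sub_distrib, ← sum_mul, hite]
    simp [sub_mul]
  rw [hrw, sub_self]

theorem sum_eq_sum_of_eq_on_pow_eq_neg (hp : p ≠ 2) {t : ℕ}
    (hE : Fintype.card E = p ^ (2 * t)) {ψ : AddChar (ZMod p) ℂ} (hψ : ψ ≠ 1)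
    {θ₁ θ₂ : Eˣ →* ℂˣ} (h₁ : θ₁ ≠ 1) (h₂ : θ₂ ≠ 1)
    (hfix₁ : ∀ u : Eˣ, (u : E) ^ p ^ t = u → θ₁ u = 1)
    (hfix₂ : ∀ u : Eˣ, (u : E) ^ p ^ t = u → θ₂ u = 1)
    (heq : ∀ u : Eˣ, (u : E) ^ p ^ t = -u → θ₁ u = θ₂ u) :
    ∑ x : Eˣ, (θ₁ x : ℂ) * ψ (Algebra.trace (ZMod p) E x) =
      ∑ x : Eˣ, (θ₂ x : ℂ) * ψ (Algebra.trace (ZMod p) E x) := by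
  have hcard : (Fintype.card (frobeniusFixed p E t) : ℂ) - 1 ≠ 0 := by
    have : Nontrivial (frobeniusFixed p E t) :=
      ⟨⟨0, ⟨1, one_pow _⟩, fun h => zero_ne_one (congrArg Subtype.val h)⟩⟩
    rw [sub_ne_zero]
    exact_mod_cast Fintype.one_lt_card.ne'
  refine mul_left_cancel₀ hcard ?_
  rw [card_sub_one_mul_sum_eq hp hE hψ h₁ hfix₁, card_sub_one_mul_sum_eq hp hE hψ h₂ hfix₂]
  congr 1
  refine sum_congr rfl fun x hx => ?_
  rw [heq x (mem_filter.1 hx).2]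

end FiniteField

section Characters

variable {E : Type} [Field E] [Fintype E]

theorem isRegularChar_of_card_lt {q : ℕ} (hE : Fintype.card E = q ^ 2) {χ : Eˣ →* ℂˣ}
    (hχ : q < orderOf χ) : IsRegularChar χ := by
  rintro K hK ⟨η, hη⟩
  have hdvd : orderOf χ ∣ Fintype.card K - 1 := by
    refine orderOf_dvd_of_pow_eq_one ?_
    ext x
    rw [MonoidHom.pow_apply, hη, ← map_pow, ← Fintype.card_units, pow_card_eq_one, map_one,
      MonoidHom.one_apply]
  have hK1 : 1 < Fintype.card K := Fintype.one_lt_card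
  have hle := Nat.le_of_dvd (by omega) hdvd
  have hrank : Fintype.card E = Fintype.card K ^ Module.finrank K E := Module.card_eq_pow_finrank
  have hne : Module.finrank K E ≠ 1 := by
    intro h
    rw [h, pow_one] at hrank
    refine hK (SetLike.coe_injective ?_)
    rw [Subfield.coe_top]
    refine Set.eq_of_subset_of_card_le (Set.subset_univ _) ?_
    rw [Fintype.card_setUniv, hrank]
    exact (Fintype.card_congr (Equiv.refl _)).le
  have hpos : 0 < Module.finrank K E := Module.finrank_pos
  have h2 : Fintype.card K ^ 2 ≤ q ^ 2 := by
    rw [← hE, hrank]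
    exact Nat.pow_le_pow_right hK1.le (by omega)
  have := (Nat.pow_le_pow_iff_left two_ne_zero).1 h2
  omega

theorem apply_eq_one_of_pow_eq {q : ℕ} (hq : 1 < q) (hE : Fintype.card E = q ^ 2)
    {χ : Eˣ →* ℂˣ} (hχ : χ ^ (q + 1) = 1) {u : Eˣ} (hu : (u : E) ^ q = u) : χ u = 1 := by
  obtain ⟨g, hg⟩ := IsCyclic.exists_generator (α := Eˣ)
  obtain ⟨k, rfl⟩ := (mem_powers_iff_mem_zpowers.2 (hg u))
  have hu' : (g ^ k) ^ (q - 1) = 1 := by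
    have h : (g ^ k) ^ (q - 1) * g ^ k = 1 * g ^ k := by
      rw [← pow_succ, Nat.sub_add_cancel hq.le, one_mul]
      exact Units.ext (by simpa using hu)
    exact mul_right_cancel h
  have hord : orderOf g = (q + 1) * (q - 1) := by
    rw [orderOf_eq_card_of_forall_mem_zpowers hg, Nat.card_eq_fintype_card,
      Fintype.card_units, hE, ← Nat.sq_sub_sq, one_pow]
  have hdvd := orderOf_dvd_of_pow_eq_one ((pow_mul g k (q - 1)).trans hu')
  rw [hord] at hdvd
  obtain ⟨m, rfl⟩ := Nat.dvd_of_mul_dvd_mul_right (by omega) hdvd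
  simp only
  rw [map_pow, pow_mul, ← MonoidHom.pow_apply, hχ, MonoidHom.one_apply, one_pow]

theorem exists_char_orderOf_eq {n : ℕ} (hn : n ∣ Fintype.card Eˣ) :
    ∃ χ : Eˣ →* ℂˣ, orderOf χ = n := by
  obtain ⟨e⟩ := CommGroup.monoidHom_mulEquiv_of_hasEnoughRootsOfUnity Eˣ ℂ
  obtain ⟨g, hg⟩ := IsCyclic.exists_generator (α := Eˣ)
  obtain ⟨m, hm⟩ := hn
  have hord : orderOf g = n * m := by
    rw [orderOf_eq_card_of_forall_mem_zpowers hg, Nat.card_eq_fintype_card, hm]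
  have hm0 : m ≠ 0 := by rintro rfl; simp at hm
  refine ⟨e.symm (g ^ m), ?_⟩
  rw [MulEquiv.orderOf_eq, orderOf_pow_of_dvd hm0 (hord ▸ dvd_mul_left m n), hord,
    Nat.mul_div_cancel _ (Nat.pos_of_ne_zero hm0)]

end Characters

/-- If `q` has small multiplicative order modulo `N`, some residue coprime to `N` has no
`q`-power multiple congruent to `1`. -/
theorem exists_coprime_mul_pow_not_modEq_one {N q s : ℕ} [NeZero N] (hs : 0 < s)
    (hq : q ^ s ≡ 1 [MOD N]) (hN : s < N.totient) :
    ∃ m : ℕ, m.Coprime N ∧ ∀ j : ℕ, ¬ m * q ^ j ≡ 1 [MOD N] := by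
  have hcop : q.Coprime N := by
    refine Nat.Coprime.coprime_dvd_left (dvd_pow_self q hs.ne') ?_
    rw [Nat.Coprime, hq.gcd_eq, Nat.gcd_one_left]
  let u := ZMod.unitOfCoprime q hcop
  have hord : orderOf u ≤ s := by
    refine orderOf_le_of_pow_eq_one hs (Units.ext ?_)
    have := (ZMod.natCast_eq_natCast_iff _ _ _).2 hq
    simpa [u] using this
  obtain ⟨v, hv⟩ : ∃ v, v ∉ Subgroup.zpowers u := by
    by_contra! h
    have := orderOf_eq_card_of_forall_mem_zpowers h
    rw [Nat.card_eq_fintype_card, ZMod.card_units_eq_totient] at this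
    omega
  refine ⟨(v : ZMod N).val, ZMod.val_coe_unit_coprime v, fun j hj => hv ?_⟩
  have hj' : v * u ^ j = 1 := by
    have := (ZMod.natCast_eq_natCast_iff _ _ _).2 hj
    refine Units.ext ?_
    simpa [u] using this
  rw [eq_inv_of_mul_eq_one_left hj']
  exact inv_mem (pow_mem (Subgroup.mem_zpowers u) j)

theorem modEq_of_pow_eq_pow {G : Type*} [Group G] {x : G} {n a b : ℕ} (hx : orderOf x = n)
    (h : x ^ a = x ^ b) : a ≡ b [MOD n] :=
  hx ▸ pow_eq_pow_iff_modEq.1 h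

theorem counterexample_n_times_one_converse_over_F3
    (t : ℕ) (ht : 3 ≤ t) (hphi : 4 * t ≤ Nat.totient (3 ^ t + 1))
    (E : Type) [Field E] [Fintype E] [Algebra (ZMod 3) E]
    (hE : Fintype.card E = 3 ^ (2 * t))
    (ψ : AddChar (ZMod 3) ℂ) (hψ : ψ ≠ 1) :
    ∃ χ₁ χ₂ : Eˣ →* ℂˣ,
      IsRegularChar χ₁ ∧ IsRegularChar χ₂ ∧
      orderOf χ₁ = 3 ^ t + 1 ∧ orderOf χ₂ = 3 ^ t + 1 ∧
      (∀ j : ℕ, ∃ x : Eˣ, χ₁ x ≠ χ₂ (x ^ 3 ^ j)) ∧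
      (∀ η : (ZMod 3)ˣ →* ℂˣ,
        twistedGaussSum (ZMod 3) χ₁ η ψ = twistedGaussSum (ZMod 3) χ₂ η ψ) := by
  have : Fact (Nat.Prime 3) := ⟨Nat.prime_three⟩
  set q := 3 ^ t with hq
  have hE2 : Fintype.card E = q ^ 2 := by rw [hE, hq, ← pow_mul, mul_comm]
  have hq3 : 3 < q := by
    calc 3 < 3 ^ 3 := by norm_num
      _ ≤ q := Nat.pow_le_pow_right (by norm_num) ht
  have hodd : Odd q := Odd.pow (by decide)
  have hunits : Fintype.card Eˣ = (q + 1) * (q - 1) := by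
    rw [Fintype.card_units, hE2, ← Nat.sq_sub_sq, one_pow]
  obtain ⟨χ, hχ⟩ := exists_char_orderOf_eq (E := E) (n := q + 1) (hunits ▸ dvd_mul_right _ _)
  have hmod : 3 ^ (2 * t) ≡ 1 [MOD q + 1] := by
    refine ((Nat.modEq_iff_dvd' (Nat.one_le_pow _ _ (by norm_num))).2 ?_).symm
    rw [← hE, ← Fintype.card_units, hunits]
    exact dvd_mul_right _ _
  obtain ⟨m, hm, hmj⟩ := exists_coprime_mul_pow_not_modEq_one (by omega) hmod (by omega)
  have hmodd : Odd m :=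
    hm.symm.coprime_dvd_left (even_iff_two_dvd.1 hodd.add_one) |>.odd_of_left
  have hχm : orderOf (χ ^ m) = q + 1 := (Nat.Coprime.orderOf_pow (hχ.symm ▸ hm.symm)).trans hχ
  refine ⟨χ, χ ^ m, isRegularChar_of_card_lt hE2 (by omega),
    isRegularChar_of_card_lt hE2 (by omega), hχ, hχm, fun j => ?_, fun η => ?_⟩
  · by_contra! h
    refine hmj j ?_
    have hpow : χ ^ (m * 3 ^ j) = χ ^ 1 := by
      ext x
      rw [pow_one, h x, map_pow, MonoidHom.pow_apply, MonoidHom.pow_apply, pow_mul]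
    exact modEq_of_pow_eq_pow hχ hpow
  · let ν : Eˣ →* ℂˣ := η.comp (Units.map (Algebra.norm (ZMod 3) : E →* ZMod 3))
    have hν (x : Eˣ) : ν x ^ 2 = 1 := by
      rw [MonoidHom.comp_apply, ← map_pow, ZMod.units_pow_card_sub_one_eq_one 3, map_one]
    have hne {θ : Eˣ →* ℂˣ} (hθ : orderOf θ = q + 1) : θ * ν ≠ 1 := by
      intro h
      have h2 : θ ^ 2 = 1 := by
        ext x
        rw [MonoidHom.pow_apply, ← mul_one (θ x ^ 2), ← hν x, ← mul_pow, ← MonoidHom.mul_apply, h,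
          MonoidHom.one_apply, one_pow]
      have := Nat.le_of_dvd two_pos (orderOf_dvd_of_pow_eq_one h2)
      omega
    have hfix {θ : Eˣ →* ℂˣ} (hθ : orderOf θ = q + 1) (u : Eˣ) (hu : (u : E) ^ q = u) :
        (θ * ν) u = 1 := by
      refine apply_eq_one_of_pow_eq (by omega) hE2 ?_ hu
      obtain ⟨k, hk⟩ := even_iff_two_dvd.1 hodd.add_one
      ext x
      rw [MonoidHom.pow_apply, MonoidHom.mul_apply, mul_pow, ← MonoidHom.pow_apply, ← hθ,
        pow_orderOf_eq_one, MonoidHom.one_apply, one_mul, hθ, hk, pow_mul, hν, one_pow]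
    refine sum_eq_sum_of_eq_on_pow_eq_neg (θ₁ := χ * ν) (θ₂ := χ ^ m * ν) (by norm_num) hE hψ
      (hne hχ) (hne hχm) (hfix hχ) (hfix hχm) fun u hu => ?_
    have hsq : χ u ^ 2 = 1 := by
      rw [← map_pow]
      refine apply_eq_one_of_pow_eq (by omega) hE2 (hχ ▸ pow_orderOf_eq_one χ) ?_
      rw [Units.val_pow_eq_pow_val, pow_right_comm, hu, neg_sq]
    obtain ⟨k, rfl⟩ := hmodd
    rw [MonoidHom.mul_apply, MonoidHom.mul_apply, MonoidHom.pow_apply, pow_succ, pow_mul, hsq,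
      one_pow, one_mul]
end
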